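/- arXiv:0908.1261 — 17 statements merged into one kernel-verified Lean document; each statement's English description precedes it below -/
import Mathlib

section
/- Let R be a ring and let x, y ∈ R with y and 1 − y invertible (then 1 − y⁻¹ = −y⁻¹(1−y) is also invertible). Then (1 − x·y)·(1 − y)⁻¹ = 1 − (1 − x)·(1 − y⁻¹)⁻¹. (This is the verification of the Δ-group identity k(xy)·k(y)⁻¹ = k(k(x)·j(y)) for the Δ-group AR, where k(u) = 1 − u and j(y) = (1 − y⁻¹)⁻¹.) -/
/-- If `y = u` and `1 - y = v` are units, then `1 - y⁻¹` is the unit `-(u⁻¹ * v)`. -/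
theorem one_sub_inv_eq_neg_inv_mul {R : Type*} [Ring R] {u v : Rˣ}
    (h : (v : R) = 1 - u) : 1 - ((u⁻¹ : Rˣ) : R) = ((-(u⁻¹ * v) : Rˣ) : R) := by
  simp [h, mul_sub]

/-- Let `R` be a ring and `x y : R` with `y` and `1 - y` invertible
(then `1 - y⁻¹ = -y⁻¹ * (1 - y)` is also invertible).  Then
`(1 - x*y) * (1 - y)⁻¹ = 1 - (1 - x) * (1 - y⁻¹)⁻¹`.
This is the verification of the Δ-group identity `k(xy)·k(y)⁻¹ = k(k(x)·j(y))`
for the Δ-group `AR`, where `k u = 1 - u` and `j y = (1 - y⁻¹)⁻¹`. -/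
theorem deltaGroup_AR_identity {R : Type*} [Ring R] (x y : R)
    (hy : IsUnit y) (hy' : IsUnit (1 - y)) :
    IsUnit (1 - Ring.inverse y) ∧
    (1 - x * y) * Ring.inverse (1 - y)
      = 1 - (1 - x) * Ring.inverse (1 - Ring.inverse y) := by
  obtain ⟨u, rfl⟩ := hy
  obtain ⟨v, hv⟩ := hy'
  have hcomm : ((v⁻¹ : Rˣ) : R) * u = u * ((v⁻¹ : Rˣ) : R) := by
    have huv : Commute (u : R) v := by
      rw [hv]
      exact (Commute.one_right _).sub_right (Commute.refl _)
    exact huv.units_inv_right.eq.symm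
  rw [← hv, Ring.inverse_unit, Ring.inverse_unit, one_sub_inv_eq_neg_inv_mul hv,
    Ring.inverse_unit]
  refine ⟨Units.isUnit _, ?_⟩
  rw [← Units.mul_left_inj v, Units.inv_mul_cancel_right, inv_neg, mul_inv_rev, inv_inv,
    Units.val_neg, Units.val_mul, hcomm, mul_neg, sub_neg_eq_add, add_mul, one_mul,
    ← mul_assoc, Units.inv_mul_cancel_right, hv]
  noncomm_ring
end

section
/- Let R be a nontrivial ring, G a group, α : G → Rˣ a group homomorphism, and β : G → R with β(g·h) = β(g)·α(h) + β(h) for all g, h ∈ G. Assume: (1) for every g ∈ G, β(g) is either zero or invertible in R; (2) for every g ∈ G, β(g) lies in the subring S of R generated by the image of α, and whenever β(g) is invertible its inverse also lies in S; (3) there exists t0 ∈ G with α(t0) = 1 and β(t0) invertible. Then S is a skew-field: every nonzero element x of S has a two-sided multiplicative inverse lying in S. -/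
/-- The translation parts of `ker α` form a right module over the subring generated by the
image of `α`. -/
theorem exists_translation_eq_mul {R : Type*} [Ring R] {G : Type*} [Group G]
    (α : G →* Rˣ) (β : G → R)
    (hβ : ∀ g h : G, β (g * h) = β g * (α h : R) + β h)
    {s : R} (hs : s ∈ Subring.closure (Set.range fun g : G => (α g : R))) :
    ∀ t : G, α t = 1 → ∃ t' : G, α t' = 1 ∧ β t' = β t * s := by
  have hone : β 1 = 0 := by simpa using hβ 1 1
  induction hs using Subring.closure_induction with
  | mem s hs =>
    obtain ⟨g, rfl⟩ := hs
    intro t ht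
    have hg : β g⁻¹ * (α g : R) + β g = 0 := by rw [← hβ, inv_mul_cancel, hone]
    refine ⟨g⁻¹ * t * g, by simp [ht], ?_⟩
    rw [hβ, hβ, ht, Units.val_one, mul_one, add_mul, add_right_comm, hg, zero_add]
  | zero => exact fun t _ => ⟨1, map_one α, by rw [hone, mul_zero]⟩
  | one => exact fun t ht => ⟨t, ht, (mul_one _).symm⟩
  | add x y _ _ ihx ihy =>
    intro t ht
    obtain ⟨a, ha, hax⟩ := ihx t ht
    obtain ⟨b, hb, hby⟩ := ihy t ht
    exact ⟨a * b, by simp [ha, hb], by simp [hβ, hb, hax, hby, mul_add]⟩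
  | neg x _ ih =>
    intro t ht
    obtain ⟨a, ha, hax⟩ := ih t ht
    refine ⟨a⁻¹, by simp [ha], ?_⟩
    have hinv : β a⁻¹ + β a = 0 := by simpa [ha, hone] using (hβ a⁻¹ a).symm
    rw [eq_neg_of_add_eq_zero_left hinv, hax, mul_neg]
  | mul x y _ _ ihx ihy =>
    intro t ht
    obtain ⟨a, ha, hax⟩ := ihx t ht
    obtain ⟨b, hb, hby⟩ := ihy a ha
    exact ⟨b, hb, by rw [hby, hax, mul_assoc]⟩

/-- Let `R` be a nontrivial ring, `G` a group, `α : G →* Rˣ` a homomorphism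
and `β : G → R` with `β (g*h) = β g * α h + β h`.  Assume: (1) every `β g` is zero or
invertible; (2) every `β g` lies in the subring `S` generated by the image of `α`, and whenever
`β g` is invertible its inverse also lies in `S`; (3) there is `t₀` with `α t₀ = 1` and
`β t₀` invertible.  Then `S` is a skew-field: every nonzero element of `S` has a two-sided
inverse lying in `S`. -/
theorem subring_is_skewfield {R : Type*} [Ring R] [Nontrivial R] {G : Type*} [Group G]
    (α : G →* Rˣ) (β : G → R)
    (hβ : ∀ g h : G, β (g * h) = β g * (α h : R) + β h)
    (h1 : ∀ g : G, β g = 0 ∨ IsUnit (β g))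
    (h2 : ∀ g : G, β g ∈ Subring.closure (Set.range fun g : G => (α g : R)))
    (h2' : ∀ (g : G) (u : Rˣ), (u : R) = β g →
      ((u⁻¹ : Rˣ) : R) ∈ Subring.closure (Set.range fun g : G => (α g : R)))
    (h3 : ∃ t₀ : G, α t₀ = 1 ∧ IsUnit (β t₀)) :
    ∀ x ∈ Subring.closure (Set.range fun g : G => (α g : R)), x ≠ 0 →
      ∃ y ∈ Subring.closure (Set.range fun g : G => (α g : R)),
        x * y = 1 ∧ y * x = 1 := by
  intro x hx hx0
  obtain ⟨t₀, ht₀, u, hu⟩ := h3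
  obtain ⟨t, -, ht⟩ := exists_translation_eq_mul α β hβ (mul_mem (h2' t₀ u hu) hx) t₀ ht₀
  rw [← hu, Units.mul_inv_cancel_left] at ht
  obtain h | ⟨v, hv⟩ := h1 t
  · exact absurd (ht.symm.trans h) hx0
  · refine ⟨_, h2' t v hv, ?_, ?_⟩ <;> simp [← ht, ← hv]
end

section
/- Let R be a nontrivial ring, G a group, α : G → Rˣ a group homomorphism, and β : G → R with β(g·h) = β(g)·α(h) + β(h) for all g, h ∈ G. Assume: (1) for every g ∈ G, β(g) is either zero or invertible in R; (2) for every g ∈ G, β(g) lies in the subring of R generated by the image of α; (3) there exists t0 ∈ G with α(t0) = 1 and β(t0) = 1. Let N = { g ∈ G | α(g) = 1 and β(g) = 0 }, a normal subgroup of G, and let ᾱ : G/N → Rˣ be the homomorphism induced by α. Then the short exact sequence 0 → {β(t) | α(t)=1} → G/N → α(G) → 1 splits: there exists a group homomorphism σ from the range of α (a subgroup of Rˣ) to G/N such that ᾱ(σ(u)) = u for every u in the range of α. -/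
/-- If `α t = 1` then conjugating `t` by `g` multiplies `β t` by `α g` on the right. -/
theorem crossed_hom_conj {R : Type*} [Ring R] {G : Type*} [Group G] (α : G →* Rˣ) (β : G → R)
    (hβ : ∀ g h : G, β (g * h) = β g * (α h : R) + β h) {t : G} (ht : α t = 1) (g : G) :
    β (g⁻¹ * t * g) = β t * (α g : R) := by
  have hone : β 1 = 0 := by simpa using hβ 1 1
  have hinv : β g⁻¹ * (α g : R) + β g = 0 := by rw [← hβ, inv_mul_cancel, hone]
  rw [hβ, hβ, ht, Units.val_one, mul_one, add_mul, add_right_comm, hinv, zero_add]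

/-- The values of `β` on `ker α` contain the subring generated by the image of `α`, as soon as
they contain `1`. -/
theorem exists_ker_of_mem_closure {R : Type*} [Ring R] {G : Type*} [Group G] (α : G →* Rˣ)
    (β : G → R) (hβ : ∀ g h : G, β (g * h) = β g * (α h : R) + β h)
    (h3 : ∃ t₀ : G, α t₀ = 1 ∧ β t₀ = 1) {x : R}
    (hx : x ∈ Subring.closure (Set.range fun g : G => (α g : R))) :
    ∃ t : G, α t = 1 ∧ β t = x := by
  have hone : β 1 = 0 := by simpa using hβ 1 1
  let T : AddSubgroup R :=
    { carrier := {x | ∃ t : G, α t = 1 ∧ β t = x}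
      zero_mem' := ⟨1, map_one α, hone⟩
      add_mem' := by
        rintro _ _ ⟨s, hs, rfl⟩ ⟨t, ht, rfl⟩
        exact ⟨s * t, by simp [hs, ht], by simp [hβ, ht]⟩
      neg_mem' := by
        rintro _ ⟨t, ht, rfl⟩
        refine ⟨t⁻¹, by simp [ht], eq_neg_of_add_eq_zero_right ?_⟩
        simpa [hone, ht] using (hβ t t⁻¹).symm }
  have hmul : ∀ y ∈ T, y * x ∈ T := by
    induction hx using Subring.closure_induction with
    | mem x hx =>
      obtain ⟨g, rfl⟩ := hx
      rintro _ ⟨t, ht, rfl⟩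
      exact ⟨g⁻¹ * t * g, by simp [ht], crossed_hom_conj α β hβ ht g⟩
    | zero => simp [T.zero_mem]
    | one => simp
    | add a b _ _ ha hb =>
      intro y hy
      rw [mul_add]
      exact T.add_mem (ha y hy) (hb y hy)
    | neg a _ ha =>
      intro y hy
      rw [mul_neg]
      exact T.neg_mem (ha y hy)
    | mul a b _ _ ha hb =>
      intro y hy
      rw [← mul_assoc]
      exact hb _ (ha y hy)
  obtain ⟨t, ht, hβt⟩ := hmul 1 h3
  exact ⟨t, ht, by rw [hβt, one_mul]⟩

/-- Let `R` be a nontrivial ring, `G` a group, `α : G →* Rˣ` a homomorphism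
and `β : G → R` with `β (g*h) = β g * α h + β h`.  Assume: (1) every `β g` is zero or
invertible; (2) every `β g` lies in the subring generated by the image of `α`; (3) there is
`t₀` with `α t₀ = 1` and `β t₀ = 1`.  Let `N = {g | α g = 1 ∧ β g = 0}` (a normal subgroup
of `G`) and let `ᾱ : G/N → Rˣ` be induced by `α`.  Then the short exact sequence
`0 → {β t | α t = 1} → G/N → α(G) → 1` splits: there is a group homomorphism
`σ : α.range →* G/N` with `ᾱ (σ u) = u` for every `u` in the range of `α`
(expressed below as: `α g = u` for every representative `g` of the coset `σ u`). -/
theorem split_exact_sequence {R : Type*} [Ring R] [Nontrivial R] {G : Type*} [Group G]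
    (α : G →* Rˣ) (β : G → R)
    (hβ : ∀ g h : G, β (g * h) = β g * (α h : R) + β h)
    (h1 : ∀ g : G, β g = 0 ∨ IsUnit (β g))
    (h2 : ∀ g : G, β g ∈ Subring.closure (Set.range fun g : G => (α g : R)))
    (h3 : ∃ t₀ : G, α t₀ = 1 ∧ β t₀ = 1)
    (N : Subgroup G) [N.Normal]
    (hN : ∀ g : G, g ∈ N ↔ (α g = 1 ∧ β g = 0)) :
    ∃ σ : α.range →* G ⧸ N,
      ∀ (u : α.range) (g : G), σ u = QuotientGroup.mk g → α g = (u : Rˣ) := by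
  have hlift : ∀ u : α.range, ∃ g : G, α g = u ∧ β g = 0 := by
    rintro ⟨_, g, rfl⟩
    obtain ⟨t, ht, hβt⟩ := exists_ker_of_mem_closure α β hβ h3 (neg_mem (h2 g))
    exact ⟨g * t, by simp [ht], by simp [hβ, ht, hβt]⟩
  choose s hαs hβs using hlift
  refine ⟨MonoidHom.mk' (fun u => (s u : G ⧸ N)) fun u v => ?_, fun u g hg => ?_⟩
  · rw [← QuotientGroup.mk_mul, QuotientGroup.eq, hN]
    have hα : α (s (u * v)) = α (s u * s v) := by simp [hαs]
    refine ⟨by rw [map_mul, map_inv, hα, inv_mul_cancel], ?_⟩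
    have hinv : β (s (u * v))⁻¹ = 0 := by
      have h := hβ (s (u * v))⁻¹ (s (u * v))
      have hone : β 1 = 0 := by simpa using hβ 1 1
      rw [inv_mul_cancel, hone, hβs, add_zero] at h
      exact (Units.mul_left_eq_zero _).mp h.symm
    simp [hβ, hinv, hβs]
  · have h := ((hN _).mp (QuotientGroup.eq.mp hg)).1
    rw [map_mul, map_inv, inv_mul_eq_one, hαs] at h
    exact h.symm
end

section
/- Let R be a ring, G a group, α : G → Rˣ a group homomorphism, and β : G → R with β(g·h) = β(g)·α(h) + β(h) for all g, h ∈ G. Assume that for every g ∈ G, β(g) is either zero or invertible in R. Then for all g, h ∈ G: if β(g) is invertible, β(h) = 0, and β(g·h·g⁻¹) = 0, then α(h) = 1. (Consequently, for a weakly special representation ρ of a group pair, the subgroup H_ρ = β⁻¹(0)/ker ρ is malnormal in G_ρ = G/ker ρ.) -/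
/-- Let `R` be a ring, `G` a group, `α : G →* Rˣ` a group homomorphism and
`β : G → R` with `β (g*h) = β g * α h + β h`.  Assume every `β g` is either zero or invertible.
Then for all `g h : G`: if `β g` is invertible, `β h = 0` and `β (g*h*g⁻¹) = 0`, then `α h = 1`.
(This is the malnormality of `H_ρ = β⁻¹(0)/ker ρ` in `G_ρ = G/ker ρ` for a weakly special
representation `ρ`.) -/
theorem weaklySpecial_malnormal {R : Type*} [Ring R] {G : Type*} [Group G]
    (α : G →* Rˣ) (β : G → R)
    (hβ : ∀ g h : G, β (g * h) = β g * (α h : R) + β h)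
    (hzu : ∀ g : G, β g = 0 ∨ IsUnit (β g)) :
    ∀ g h : G, IsUnit (β g) → β h = 0 → β (g * h * g⁻¹) = 0 → α h = 1 := by
  intro g h hg hh hc
  have hmul : β g * (α h : R) = β g * 1 := by
    have hconj := hβ (g * h * g⁻¹) g
    rw [inv_mul_cancel_right, hβ g h, hh, hc] at hconj
    simpa using hconj
  exact Units.ext (hg.mul_left_cancel hmul)
end

section
/- Let R be a ring and let p, q, x ∈ R satisfy the three identities p = x − x², q = p·x − 3·p − x + 1, and p·q = q. Then p is invertible in R if and only if 2·q + p² + 4·p − 1 = 0. Moreover, when this equation holds, p⁻¹ = 5 − 3·p − p². -/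
/-- Let `R` be a ring (associative, unital, not necessarily commutative) and
`p q x : R` with `p = x - x^2`, `q = p*x - 3*p - x + 1` and `p*q = q`.  Then `p` is invertible
iff `2*q + p^2 + 4*p - 1 = 0`; moreover, when this equation holds,
`p⁻¹ = 5 - 3*p - p^2` (i.e. `5 - 3*p - p^2` is a two-sided inverse of `p`). -/
theorem invertibility_criterion {R : Type*} [Ring R] (p q x : R)
    (hp : p = x - x ^ 2)
    (hq : q = p * x - 3 * p - x + 1)
    (hpq : p * q = q) :
    (IsUnit p ↔ 2 * q + p ^ 2 + 4 * p - 1 = 0) ∧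
    (2 * q + p ^ 2 + 4 * p - 1 = 0 →
      p * (5 - 3 * p - p ^ 2) = 1 ∧ (5 - 3 * p - p ^ 2) * p = 1) := by
  have annihilated : p * (2 * q + p ^ 2 + 4 * p - 1) = -x * (p * q - q) := by
    subst hq hp
    noncomm_ring
  have inverse_of_eq (h : 2 * q + p ^ 2 + 4 * p - 1 = 0) :
      p * (5 - 3 * p - p ^ 2) = 1 := by
    have key : p * (5 - 3 * p - p ^ 2) - 1 =
        2 * (p * q - q) - (p - 1) * (2 * q + p ^ 2 + 4 * p - 1) := by
      noncomm_ring
    rwa [hpq, h, sub_self, mul_zero, mul_zero, sub_zero, sub_eq_zero] at key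
  have comm : (5 - 3 * p - p ^ 2) * p = p * (5 - 3 * p - p ^ 2) := by
    noncomm_ring
  refine ⟨⟨fun hu => ?_, fun h => ?_⟩, fun h => ⟨inverse_of_eq h, comm.trans (inverse_of_eq h)⟩⟩
  · rwa [hpq, sub_self, mul_zero, hu.mul_right_eq_zero] at annihilated
  · exact isUnit_iff_exists.2 ⟨_, inverse_of_eq h, comm.trans (inverse_of_eq h)⟩
end

section
/- Let R be a ring and let p, q, x ∈ R satisfy p = x − x², q = p·x − 3·p − x + 1, and p·q = q. Then q² = −2·q and 2·q + p·(p² + 4·p − 1) = 0. -/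
/-- Let `R` be a ring and `p q x : R` with `p = x - x^2`,
`q = p*x - 3*p - x + 1` and `p*q = q`.  Then `q^2 = -2*q` and
`2*q + p*(p^2 + 4*p - 1) = 0`. -/
theorem auxiliary_identities {R : Type*} [Ring R] (p q x : R)
    (hp : p = x - x ^ 2)
    (hq : q = p * x - 3 * p - x + 1)
    (hpq : p * q = q) :
    q ^ 2 = -2 * q ∧ 2 * q + p * (p ^ 2 + 4 * p - 1) = 0 := by
  have hzero : p * q - q = 0 := sub_eq_zero.mpr hpq
  constructor
  · have hfactor : q ^ 2 + 2 * q = (x - 3) * (p * q - q) := by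
      subst hq hp
      grind
    rw [hzero, mul_zero] at hfactor
    rw [neg_mul]
    exact eq_neg_of_add_eq_zero_left hfactor
  · have hfactor : 2 * q + p * (p ^ 2 + 4 * p - 1) = -(x + 2) * (p * q - q) := by
      subst hq hp
      grind
    rw [hfactor, hzero, mul_zero]
end

section
/- Let R be a ring and let p, r, x ∈ R satisfy the five relations: x² = x − p; p·x = x + 3·p + r² − 1; p·r = r; r·x + x·r = r − r²; p² = 1 − 4·p − 2·r². Set a = 2 + 2·p + r + 2·x + 3·r² + r·x. Then the elements 2, r, and 1 − p all belong to the two-sided ideal of R generated by a. In particular, 2 + r = (1 − x − r² − 2·r·x)·a, r = (−2 + p + 3·r + 4·x − r·x)·a + (2 + r)·x, and 1 − p = 2·x + r²·x. -/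
/-- Let `R` be a ring and `p r x : R` satisfying the five defining relations of
the ring `S` associated to the figure-eight knot: `x^2 = x - p`, `p*x = x + 3*p + r^2 - 1`,
`p*r = r`, `r*x + x*r = r - r^2`, `p^2 = 1 - 4*p - 2*r^2`.
Set `a = 2 + 2*p + r + 2*x + 3*r^2 + r*x`.  Then `2`, `r` and `1 - p` belong to the two-sided
ideal of `R` generated by `a`.  In particular `2 + r = (1 - x - r^2 - 2*r*x)*a`,
`r = (-2 + p + 3*r + 4*x - r*x)*a + (2 + r)*x` and `1 - p = 2*x + r^2*x`. -/
theorem figure_eight_ideal_lemma {R : Type*} [Ring R] (p r x : R)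
    (h1 : x ^ 2 = x - p)
    (h2 : p * x = x + 3 * p + r ^ 2 - 1)
    (h3 : p * r = r)
    (h4 : r * x + x * r = r - r ^ 2)
    (h5 : p ^ 2 = 1 - 4 * p - 2 * r ^ 2) :
    ((2 : R) ∈ TwoSidedIdeal.span {2 + 2 * p + r + 2 * x + 3 * r ^ 2 + r * x} ∧
     r ∈ TwoSidedIdeal.span {2 + 2 * p + r + 2 * x + 3 * r ^ 2 + r * x} ∧
     1 - p ∈ TwoSidedIdeal.span {2 + 2 * p + r + 2 * x + 3 * r ^ 2 + r * x}) ∧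
    2 + r = (1 - x - r ^ 2 - 2 * (r * x)) * (2 + 2 * p + r + 2 * x + 3 * r ^ 2 + r * x) ∧
    r = (-2 + p + 3 * r + 4 * x - r * x) * (2 + 2 * p + r + 2 * x + 3 * r ^ 2 + r * x)
        + (2 + r) * x ∧
    1 - p = 2 * x + r ^ 2 * x := by
  have hxr : x * r = r - r * r - r * x := by
    rw [← sq, ← h4]; abel
  have hp : p = x - x * x := by
    rw [← sq, h1]; abel
  have hpx : p * x = x * p := by
    rw [hp]; noncomm_ring
  -- `p * x * r = x * r` because `p` commutes with `x` and fixes `r`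
  have hrrr : r * (r * r) = -(2 * r) := by
    have h := congrArg (· * r) h2
    simp only [hpx, mul_assoc, h3, sub_mul, add_mul, one_mul, sq] at h
    linear_combination (norm := noncomm_ring) -h
  have hid : 1 - p = 2 * x + r ^ 2 * x := by
    have h := congrArg (· * x) h2
    have hpxx : p * x * x = p * x - p ^ 2 := by
      rw [mul_assoc, ← sq, h1, mul_sub, sq]
    simp only [hpxx, add_mul, sub_mul, one_mul, mul_assoc, ← sq x, h1] at h
    rw [h2, h5] at h
    linear_combination (norm := noncomm_ring) h
  have hp' : p = 1 - 2 * x - r * (r * x) := by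
    rw [← mul_assoc, ← sq, sub_sub, ← hid]; abel
  have hxx : x * x = 3 * x + r * (r * x) - 1 := by
    rw [← sq, h1, hp']; noncomm_ring
  have hxr_assoc (t : R) : x * (r * t) = r * t - r * (r * t) - r * (x * t) := by
    rw [← mul_assoc, hxr]; simp only [sub_mul, mul_assoc]
  have hrrr_assoc (t : R) : r * (r * (r * t)) = -(2 * (r * t)) := by
    rw [← mul_assoc r r, ← mul_assoc, mul_assoc r r r, hrrr, neg_mul, mul_assoc]
  have hr2 (t : R) : r * (2 * t) = 2 * (r * t) := by noncomm_ring
  have hr3 (t : R) : r * (3 * t) = 3 * (r * t) := by noncomm_ring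
  have hx2 (t : R) : x * (2 * t) = 2 * (x * t) := by noncomm_ring
  have hx3 (t : R) : x * (3 * t) = 3 * (x * t) := by noncomm_ring
  have htwo_add : 2 + r = (1 - x - r ^ 2 - 2 * (r * x)) *
      (2 + 2 * p + r + 2 * x + 3 * r ^ 2 + r * x) := by
    rw [hp']
    simp only [sq, mul_add, mul_sub, sub_mul, one_mul, mul_one, mul_neg,
      mul_assoc, hxr, hrrr, hxx, hxr_assoc, hrrr_assoc,
      mul_two, hr2, hr3, hx2, hx3]
    clear * -
    grind only
  have hr : r = (-2 + p + 3 * r + 4 * x - r * x) *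
      (2 + 2 * p + r + 2 * x + 3 * r ^ 2 + r * x) + (2 + r) * x := by
    rw [hp']
    simp only [sq, mul_add, add_mul, mul_sub, sub_mul, one_mul, mul_one, mul_neg, neg_mul,
      mul_assoc, hxr, hrrr, hxx, hxr_assoc, hrrr_assoc,
      mul_two, hr2, hr3, hx2, hx3]
    clear * -
    grind only
  refine ⟨?_, htwo_add, hr, hid⟩
  set a := 2 + 2 * p + r + 2 * x + 3 * r ^ 2 + r * x
  have ha : a ∈ TwoSidedIdeal.span {a} := TwoSidedIdeal.subset_span rfl
  have htwo_add_mem : 2 + r ∈ TwoSidedIdeal.span {a} := by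
    rw [htwo_add]; exact TwoSidedIdeal.mul_mem_left _ _ _ ha
  have hr_mem : r ∈ TwoSidedIdeal.span {a} := by
    rw [hr]
    exact add_mem (TwoSidedIdeal.mul_mem_left _ _ _ ha)
      (TwoSidedIdeal.mul_mem_right _ _ _ htwo_add_mem)
  have htwo_mem : 2 ∈ TwoSidedIdeal.span {a} := by
    simpa using sub_mem htwo_add_mem hr_mem
  refine ⟨htwo_mem, hr_mem, ?_⟩
  rw [hid, sq, mul_assoc]
  exact add_mem (TwoSidedIdeal.mul_mem_right _ _ _ htwo_mem)
    (TwoSidedIdeal.mul_mem_right _ _ _ hr_mem)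
end

section
/- Let R be a ring, G a group, s : G → Rˣ a group homomorphism, and v : G → R a map satisfying v(x·y) = v(x)·s(y) + v(y) for all x, y ∈ G. Then v(1) = 0, and for every y ∈ G such that v(y⁻¹) is invertible in R: (a) s(y) = −v(y⁻¹)⁻¹·v(y) (as elements of R); and (b) for every x ∈ G, v(x⁻¹·y) = v(y) − v(x⁻¹)·v(y⁻¹)⁻¹·v(y). In particular, if also v(y) is invertible, then v(x⁻¹·y)·v(y)⁻¹ + v(x⁻¹)·v(y⁻¹)⁻¹ = 1. -/
/-- Let `R` be a ring, `G` a group, `s : G →* Rˣ` a group homomorphism and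
`v : G → R` with `v (x*y) = v x * s y + v y`.  Then `v 1 = 0`, and for every `y` with
`v y⁻¹` invertible: (a) `(s y : R) = - (v y⁻¹)⁻¹ * v y`; (b) for every `x`,
`v (x⁻¹*y) = v y - v x⁻¹ * (v y⁻¹)⁻¹ * v y`; in particular, if also `v y` is invertible,
`v (x⁻¹*y) * (v y)⁻¹ + v x⁻¹ * (v y⁻¹)⁻¹ = 1`. -/
theorem q_homomorphism_identities {R : Type*} [Ring R] {G : Type*} [Group G]
    (s : G →* Rˣ) (v : G → R)
    (hv : ∀ x y : G, v (x * y) = v x * (s y : R) + v y) :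
    v 1 = 0 ∧
    ∀ y : G, IsUnit (v y⁻¹) →
      ((s y : R) = -(Ring.inverse (v y⁻¹)) * v y) ∧
      (∀ x : G, v (x⁻¹ * y) = v y - v x⁻¹ * Ring.inverse (v y⁻¹) * v y) ∧
      (IsUnit (v y) → ∀ x : G,
        v (x⁻¹ * y) * Ring.inverse (v y) + v x⁻¹ * Ring.inverse (v y⁻¹) = 1) := by
  have h1 : v 1 = 0 := by simpa using hv 1 1
  refine ⟨h1, fun y hy => ?_⟩
  have hs : (s y : R) = -(Ring.inverse (v y⁻¹)) * v y := by
    have h : v y⁻¹ * (s y : R) = -v y := by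
      rw [eq_neg_iff_add_eq_zero, ← hv, inv_mul_cancel, h1]
    rw [neg_mul, ← mul_neg, ← h, Ring.inverse_mul_cancel_left _ _ hy]
  have hb : ∀ x : G, v (x⁻¹ * y) = v y - v x⁻¹ * Ring.inverse (v y⁻¹) * v y := by
    intro x
    rw [hv, hs]
    noncomm_ring
  refine ⟨hs, hb, fun hy' x => ?_⟩
  rw [hb, sub_mul, Ring.mul_inverse_cancel_right _ _ hy', Ring.mul_inverse_cancel _ hy',
    sub_add_cancel]
end

section
/- Let G be a group, H a proper subgroup of G, and R a ring. Suppose u assigns to each pair (x, y) with x, y ∈ G∖H an invertible element u(x,y) ∈ Rˣ such that: (i) u(x,y)·u(y,z) = u(x,z) for all x, y, z ∈ G∖H; (ii) u(x·h, y) = u(x, y·h) = u(h·x, h·y) = u(x,y) for all h ∈ H and x, y ∈ G∖H; (iii) u(y⁻¹·x, y⁻¹) + u(x,y) = 1 in R whenever x, y, y⁻¹·x ∈ G∖H. Fix g ∈ G∖H and define F : G → R by F(x) = u(g, x·g) if x ∈ H and F(x) = −u(g, x)·u(x⁻¹, g) if x ∉ H. Then F(x·y) = F(x)·F(y) for all x,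 y ∈ G, F(1) = 1, and F(x⁻¹)·F(x) = 1 for all x ∈ G. -/
/-- Let `G` be a group, `H` a proper subgroup and `R` a ring.  Suppose `u`
assigns to each pair of elements of `G∖H` an invertible element of `R` satisfying the defining
relations (i)–(iii) of the ring `A'𝒢_{G,H}`:
(i) `u x y * u y z = u x z`; (ii) `u (x*h) y = u x (y*h) = u (h*x) (h*y) = u x y` for `h ∈ H`;
(iii) `u (y⁻¹*x) y⁻¹ + u x y = 1` whenever `x, y, y⁻¹*x ∉ H`.
Fix `g ∉ H` and define `F : G → R` by `F x = u g (x*g)` for `x ∈ H` and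
`F x = -(u g x * u x⁻¹ g)` for `x ∉ H`.  Then `F (x*y) = F x * F y` for all `x y`,
`F 1 = 1`, and `F x⁻¹ * F x = 1` for all `x`. -/
theorem f_g_is_multiplicative {G : Type*} [Group G] (H : Subgroup G) (hH : H ≠ ⊤)
    {R : Type*} [Ring R] (u : G → G → Rˣ)
    (hi : ∀ x y z : G, x ∉ H → y ∉ H → z ∉ H → u x y * u y z = u x z)
    (hii : ∀ (h : G), h ∈ H → ∀ x y : G, x ∉ H → y ∉ H →
      u (x * h) y = u x y ∧ u x (y * h) = u x y ∧ u (h * x) (h * y) = u x y)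
    (hiii : ∀ x y : G, x ∉ H → y ∉ H → y⁻¹ * x ∉ H →
      ((u (y⁻¹ * x) y⁻¹ : R) + (u x y : R) = 1))
    (g : G) (hg : g ∉ H)
    (F : G → R)
    (hF1 : ∀ x : G, x ∈ H → F x = (u g (x * g) : R))
    (hF2 : ∀ x : G, x ∉ H → F x = -((u g x : R) * (u x⁻¹ g : R))) :
    (∀ x y : G, F (x * y) = F x * F y) ∧ F 1 = 1 ∧ ∀ x : G, F x⁻¹ * F x = 1 := by
  have hself : ∀ x, x ∉ H → u x x = 1 := fun x hx => by
    simpa using hi x x x hx hx hx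
  have hinv : ∀ x y, x ∉ H → y ∉ H → (u x y)⁻¹ = u y x := fun x y hx hy =>
    inv_eq_of_mul_eq_one_right (by rw [hi x y x hx hy hx, hself x hx])
  have hL : ∀ {h x}, h ∈ H → x ∉ H → h * x ∉ H := fun hh hx hhx =>
    hx ((H.mul_mem_cancel_left hh).1 hhx)
  have hI : ∀ {x}, x ∉ H → x⁻¹ ∉ H := fun hx hx' => hx (H.inv_mem_iff.1 hx')
  have hone : F 1 = 1 := by
    rw [hF1 1 H.one_mem, one_mul, hself g hg, Units.val_one]
  have hmul : ∀ x y : G, F (x * y) = F x * F y := by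
    intro x y
    by_cases hx : x ∈ H <;> by_cases hy : y ∈ H
    · rw [hF1 _ (H.mul_mem hx hy), hF1 x hx, hF1 y hy, ← Units.val_mul,
        ← (hii x hx g (y * g) hg (hL hy hg)).2.2,
        hi _ _ _ hg (hL hx hg) (hL hx (hL hy hg)), mul_assoc]
    · have hxy : x * y ∉ H := hL hx hy
      rw [hF2 _ hxy, hF1 x hx, hF2 y hy, mul_inv_rev,
        (hii x⁻¹ (H.inv_mem hx) y⁻¹ g (hI hy) hg).1, mul_neg, ← mul_assoc,
        ← Units.val_mul (u g (x * g)), ← (hii x hx g y hg hy).2.2,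
        hi _ _ _ hg (hL hx hg) hxy]
    · have hxy : x * y ∉ H := fun h => hx ((H.mul_mem_cancel_right hy).1 h)
      rw [hF2 _ hxy, hF2 x hx, hF1 y hy, mul_inv_rev, (hii y hy g x hg hx).2.1,
        ← (hii y hy (y⁻¹ * x⁻¹) g (hL (H.inv_mem hy) (hI hx)) hg).2.2,
        mul_inv_cancel_left, neg_mul, mul_assoc, ← Units.val_mul (u x⁻¹ g),
        hi _ _ _ (hI hx) hg (hL hy hg)]
    · have hprod : F x * F y = ((u g x * u x⁻¹ y * u y⁻¹ g : Rˣ) : R) := by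
        rw [hF2 x hx, hF2 y hy, ← hi x⁻¹ g y (hI hx) hg hy]
        simp only [Units.val_mul, neg_mul_neg, mul_assoc]
      rw [hprod]
      by_cases hxy : x * y ∈ H
      · have hmid : u x⁻¹ y = 1 := by
          have := (hii (x * y) hxy x⁻¹ x⁻¹ (hI hx) (hI hx)).2.1
          rwa [inv_mul_cancel_left, hself _ (hI hx)] at this
        have hlast : u y⁻¹ g = u x (x * y * g) := by
          rw [← (hii (x * y) hxy y⁻¹ g (hI hy) hg).2.2, mul_inv_cancel_right]
        rw [hF1 _ hxy, hmid, hlast, mul_one, hi _ _ _ hg hx (hL hxy hg)]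
      · have hyx : y⁻¹ * x⁻¹ ∉ H := by simpa using hI hxy
        have h₁ := hiii x⁻¹ y (hI hx) hy hyx
        have h₂ := hiii y x⁻¹ hy (hI hx) (by simpa using hxy)
        rw [inv_inv, ← hinv x⁻¹ y (hI hx) hy] at h₂
        -- With `a = u x⁻¹ y`, this is `a = -(1 - a⁻¹)⁻¹ * (1 - a)`.
        have key : (u x⁻¹ y : R) = -((u x (x * y) : R) * (u (y⁻¹ * x⁻¹) y⁻¹ : R)) := by
          rw [← hinv (x * y) x hxy hx, ← mul_neg, Units.eq_inv_mul_iff_mul_eq,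
            eq_sub_of_add_eq h₂, eq_sub_of_add_eq h₁, sub_mul, Units.inv_mul, one_mul, neg_sub]
        rw [hF2 _ hxy, mul_inv_rev, ← hi g x (x * y) hg hx hxy,
          ← hi (y⁻¹ * x⁻¹) y⁻¹ g hyx (hI hy) hg]
        simp only [Units.val_mul, key, mul_neg, neg_mul, mul_assoc]
  exact ⟨hmul, hone, fun x => by rw [← hmul, inv_mul_cancel, hone]⟩
end

section
/- Let G be a group, H a proper subgroup of G, and R a ring. Suppose u assigns to each pair (x, y) with x, y ∈ G∖H an invertible element u(x,y) ∈ Rˣ such that: (i) u(x,y)·u(y,z) = u(x,z) for all x, y, z ∈ G∖H; (ii) u(x·h, y) = u(x, y·h) = u(h·x, h·y) = u(x,y) for all h ∈ H and x, y ∈ G∖H; (iii) u(y⁻¹·x, y⁻¹) + u(x,y) = 1 in R whenever x, y, y⁻¹·x ∈ G∖H. Fix g ∈ G∖H; define F : G → R by F(x) = u(g, x·g) if x ∈ H and F(x) = −u(g, x)·u(x⁻¹, g) if x ∉ H, and define W : G → R by W(x) = 0 if x ∈ H and W(x) = u(x⁻¹, g) if x ∉ H. Then W(x·y) = W(y) +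 W(x)·F(y) for all x, y ∈ G. -/
/-- Same setup as Statement 11: `G` a group, `H` a proper subgroup, `R` a
ring, `u` assigning to pairs of elements of `G∖H` invertible elements of `R` subject to the
relations (i)–(iii) of the ring `A'𝒢_{G,H}`.  Fix `g ∉ H`, define `F : G → R` by
`F x = u g (x*g)` for `x ∈ H` and `F x = -(u g x * u x⁻¹ g)` for `x ∉ H`, and define
`W : G → R` by `W x = 0` for `x ∈ H` and `W x = u x⁻¹ g` for `x ∉ H`.
Then `W (x*y) = W y + W x * F y` for all `x y ∈ G`. -/
theorem f_g_cocycle {G : Type*} [Group G] (H : Subgroup G) (hH : H ≠ ⊤)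
    {R : Type*} [Ring R] (u : G → G → Rˣ)
    (hi : ∀ x y z : G, x ∉ H → y ∉ H → z ∉ H → u x y * u y z = u x z)
    (hii : ∀ (h : G), h ∈ H → ∀ x y : G, x ∉ H → y ∉ H →
      u (x * h) y = u x y ∧ u x (y * h) = u x y ∧ u (h * x) (h * y) = u x y)
    (hiii : ∀ x y : G, x ∉ H → y ∉ H → y⁻¹ * x ∉ H →
      ((u (y⁻¹ * x) y⁻¹ : R) + (u x y : R) = 1))
    (g : G) (hg : g ∉ H)
    (F : G → R)
    (hF1 : ∀ x : G, x ∈ H → F x = (u g (x * g) : R))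
    (hF2 : ∀ x : G, x ∉ H → F x = -((u g x : R) * (u x⁻¹ g : R)))
    (W : G → R)
    (hW1 : ∀ x : G, x ∈ H → W x = 0)
    (hW2 : ∀ x : G, x ∉ H → W x = (u x⁻¹ g : R)) :
    ∀ x y : G, W (x * y) = W y + W x * F y := by
  have hinv : ∀ {x : G}, x ∉ H → x⁻¹ ∉ H := fun hx h => hx (inv_mem_iff.mp h)
  have hiR : ∀ x y z : G, x ∉ H → y ∉ H → z ∉ H → (u x y : R) * (u y z : R) = (u x z : R) :=
    fun x y z hx hy hz => by rw [← Units.val_mul, hi x y z hx hy hz]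
  intro x y
  by_cases hx : x ∈ H
  · rw [hW1 x hx, zero_mul, add_zero]
    by_cases hy : y ∈ H
    · rw [hW1 _ (H.mul_mem hx hy), hW1 y hy]
    · have hxy : x * y ∉ H := fun h => hy ((H.mul_mem_cancel_left hx).mp h)
      rw [hW2 _ hxy, hW2 y hy, mul_inv_rev,
        (hii x⁻¹ (H.inv_mem hx) y⁻¹ g (hinv hy) hg).1]
  · rw [hW2 x hx]
    by_cases hy : y ∈ H
    · have hxy : x * y ∉ H := fun h => hx ((H.mul_mem_cancel_right hy).mp h)
      have hyg : y * g ∉ H := fun h => hg ((H.mul_mem_cancel_left hy).mp h)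
      have hu := (hii y⁻¹ (H.inv_mem hy) x⁻¹ (y * g) (hinv hx) hyg).2.2
      rw [inv_mul_cancel_left] at hu
      rw [hW1 y hy, hF1 y hy, hW2 _ hxy, zero_add, hiR _ _ _ (hinv hx) hg hyg, mul_inv_rev, hu]
    · rw [hW2 y hy, hF2 y hy, mul_neg, ← mul_assoc, hiR _ _ _ (hinv hx) hg hy]
      by_cases hxy : x * y ∈ H
      · have hu : u x⁻¹ y = 1 := by
          have h := (hii (x * y) hxy x⁻¹ x⁻¹ (hinv hx) (hinv hx)).2.1
          rw [inv_mul_cancel_left] at h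
          rw [h]
          exact mul_eq_left.mp (hi _ _ _ (hinv hx) (hinv hx) (hinv hx))
        rw [hW1 _ hxy, hu, Units.val_one, one_mul, add_neg_cancel]
      · have hyx : y⁻¹ * x⁻¹ ∉ H := by
          rw [← mul_inv_rev]
          exact hinv hxy
        rw [hW2 _ hxy, mul_inv_rev, ← hiR _ _ _ hyx (hinv hy) hg,
          eq_sub_of_add_eq (hiii x⁻¹ y (hinv hx) hy hyx), sub_mul, one_mul, sub_eq_add_neg]
end

section
/- Let G = ⟨a, b | a² = b³⟩ be the trefoil knot group (the presented group on two generators a, b with the single relator a²·b⁻³), and let H be the subgroup of G generated by a·b⁻¹ and a². Let R be a nontrivial ring, α : G → Rˣ a group homomorphism, and β : G → R a map with β(g·h) = β(g)·α(h) + β(h) for all g, h ∈ G. Assume: β(h) = 0 for all h ∈ H; for every g ∈ G, β(g) is either zero or invertible in R; and β is not identically zero. Then β(a) = β(b), β(a) is invertible, α(a) = −1 in R, and α(b)² + α(b) + 1 = 0 in R (equivalently t² − t + 1 = 0 for t = −α(b)⁻¹). -/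
/-- The single relator `a² b⁻³` of the trefoil knot group. -/
def trefoilRels : Set (FreeGroup (Fin 2)) :=
  {FreeGroup.of 0 ^ 2 * (FreeGroup.of 1 ^ 3)⁻¹}

/-- The trefoil knot group `G = ⟨a, b | a² = b³⟩`. -/
abbrev TrefoilGroup := PresentedGroup trefoilRels

/-- The vanishing locus of a crossed homomorphism `β` twisted by `α` is a subgroup. -/
def crossedKernel {G R : Type*} [Group G] [Ring R] (α : G →* Rˣ) (β : G → R)
    (hβ : ∀ g h : G, β (g * h) = β g * (α h : R) + β h) : Subgroup G where
  carrier := {g | β g = 0}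
  one_mem' := by simpa using hβ 1 1
  mul_mem' {g h} hg hh := by
    rw [Set.mem_ofPred_eq] at *
    rw [hβ, hg, hh, zero_mul, zero_add]
  inv_mem' {g} hg := by
    rw [Set.mem_ofPred_eq] at *
    have h1 : β 1 = 0 := by simpa using hβ 1 1
    have h := hβ g⁻¹ g
    rw [inv_mul_cancel, h1, hg, add_zero] at h
    exact (Units.mul_left_eq_zero (α g)).1 h.symm

theorem TrefoilGroup.sq_eq_cube :
    (PresentedGroup.of 0 : TrefoilGroup) ^ 2 = PresentedGroup.of 1 ^ 3 := by
  have h := PresentedGroup.one_of_mem (rels := trefoilRels) (Set.mem_singleton _)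
  rw [map_mul, map_inv, map_pow, map_pow] at h
  exact mul_inv_eq_one.1 h

/-- Let `G = ⟨a, b | a² = b³⟩` be the trefoil knot group and `H` the subgroup
generated by `a*b⁻¹` and `a²` (the peripheral subgroup).  Let `R` be a nontrivial ring,
`α : G →* Rˣ` a homomorphism and `β : G → R` with `β (g*h) = β g * α h + β h`.  Assume `β`
vanishes on `H`, every `β g` is zero or invertible, and `β` is not identically zero.  Then
`β a = β b`, `β a` is invertible, `α a = -1` in `R`, and `α b ^ 2 + α b + 1 = 0` in `R`
(equivalently `t² - t + 1 = 0` for `t = -α b⁻¹`). -/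
theorem trefoil_weakly_special {R : Type*} [Ring R] [Nontrivial R]
    (α : TrefoilGroup →* Rˣ) (β : TrefoilGroup → R)
    (hβ : ∀ g h : TrefoilGroup, β (g * h) = β g * (α h : R) + β h)
    (hH : ∀ h ∈ Subgroup.closure
      ({PresentedGroup.of 0 * (PresentedGroup.of 1)⁻¹, PresentedGroup.of 0 ^ 2} :
        Set TrefoilGroup), β h = 0)
    (hzu : ∀ g : TrefoilGroup, β g = 0 ∨ IsUnit (β g))
    (hnz : ∃ g : TrefoilGroup, β g ≠ 0) :
    β (PresentedGroup.of 0) = β (PresentedGroup.of 1) ∧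
    IsUnit (β (PresentedGroup.of 0)) ∧
    ((α (PresentedGroup.of 0) : R) = -1) ∧
    ((α (PresentedGroup.of 1) : R) ^ 2 + (α (PresentedGroup.of 1) : R) + 1 = 0) := by
  have hab : β (PresentedGroup.of 0) = β (PresentedGroup.of 1) := by
    have h := hβ (PresentedGroup.of 0 * (PresentedGroup.of 1)⁻¹) (PresentedGroup.of 1)
    rwa [hH _ (Subgroup.subset_closure (Set.mem_insert _ _)), inv_mul_cancel_right,
      zero_mul, zero_add] at h
  have hsq : β (PresentedGroup.of 0 ^ 2) = 0 :=
    hH _ (Subgroup.subset_closure (Set.mem_insert_of_mem _ rfl))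
  have hu : IsUnit (β (PresentedGroup.of 0)) := by
    refine (hzu _).resolve_left fun h0 => ?_
    obtain ⟨g, hg⟩ := hnz
    have hle : Subgroup.closure (Set.range (PresentedGroup.of (rels := trefoilRels))) ≤
        crossedKernel α β hβ := by
      rw [Subgroup.closure_le]
      rintro _ ⟨i, rfl⟩
      fin_cases i
      · exact h0
      · exact hab.symm.trans h0
    rw [PresentedGroup.closure_range_of] at hle
    exact hg (hle (Subgroup.mem_top g))
  refine ⟨hab, hu, ?_, ?_⟩
  · refine eq_neg_of_add_eq_zero_left (hu.mul_right_eq_zero.1 ?_)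
    rw [mul_add, mul_one, ← hβ, ← sq, hsq]
  · rw [hab] at hu
    refine hu.mul_right_eq_zero.1 ?_
    rw [TrefoilGroup.sq_eq_cube, pow_succ, sq, hβ, hβ] at hsq
    rw [← hsq]
    noncomm_ring
end

section
/- Let G = ⟨a, b | a² = b³⟩ be the trefoil knot group and let R = ℤ[t]/(t² − t + 1) (so t is a unit of R with t⁻¹ = 1 − t). Then: (1) there is a (unique) group homomorphism α : G → Rˣ with α(a) = −1 and α(b) = −t⁻¹, together with a (unique) map β : G → R satisfying β(g·h) = β(g)·α(h) + β(h) for all g, h ∈ G and β(a) = β(b) = 1; and (2) the subgroup { g ∈ G | α(g) = 1 and β(g) = 0 } equals the normal closure in G of the set { a², (a·b⁻¹)⁶ }. -/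
/-- The single relator `a² b⁻³` of the trefoil knot group. -/
def trefoilRels14 : Set (FreeGroup (Fin 2)) :=
  {FreeGroup.of 0 ^ 2 * (FreeGroup.of 1 ^ 3)⁻¹}

/-- The trefoil knot group `G = ⟨a, b | a² = b³⟩`. -/
abbrev TrefoilGroup14 := PresentedGroup trefoilRels14

/-- The ring `ℤ[t]/(t² - t + 1)`, the quotient of `ℤ[t]` by the Alexander polynomial
of the trefoil.  In it, `t` is a unit with `t⁻¹ = 1 - t`. -/
abbrev TrefoilRing :=
  Polynomial ℤ ⧸ Ideal.span ({Polynomial.X ^ 2 - Polynomial.X + 1} : Set (Polynomial ℤ))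

/-- The image of `t` in `ℤ[t]/(t² - t + 1)`. -/
noncomputable def tbar : TrefoilRing :=
  Ideal.Quotient.mk _ Polynomial.X

/-- The affine group `Rˣ ⋉ R` acting on `R` from the right, `v ↦ v * linear + translation`. -/
@[ext]
structure RightAffine (R : Type*) [CommRing R] where
  /-- The linear part. -/
  linear : Rˣ
  /-- The image of `0`. -/
  translation : R

namespace RightAffine

variable {R : Type*} [CommRing R]

instance : Mul (RightAffine R) :=
  ⟨fun p q => ⟨p.linear * q.linear, p.translation * q.linear + q.translation⟩⟩

instance : One (RightAffine R) := ⟨⟨1, 0⟩⟩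

instance : Inv (RightAffine R) :=
  ⟨fun p => ⟨p.linear⁻¹, -(p.translation * (p.linear⁻¹ : Rˣ))⟩⟩

@[simp] lemma mul_linear (p q : RightAffine R) : (p * q).linear = p.linear * q.linear := rfl

@[simp] lemma mul_translation (p q : RightAffine R) :
    (p * q).translation = p.translation * q.linear + q.translation := rfl

@[simp] lemma one_linear : (1 : RightAffine R).linear = 1 := rfl

@[simp] lemma one_translation : (1 : RightAffine R).translation = 0 := rfl

@[simp] lemma inv_linear (p : RightAffine R) : p⁻¹.linear = p.linear⁻¹ := rfl

@[simp] lemma inv_translation (p : RightAffine R) :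
    p⁻¹.translation = -(p.translation * (p.linear⁻¹ : Rˣ)) := rfl

instance : Group (RightAffine R) :=
  Group.ofLeftAxioms
    (fun p q r => by ext <;> simp <;> ring)
    (fun p => by ext <;> simp)
    (fun p => by ext <;> simp)

/-- The homomorphism to the affine group given by a character and a crossed homomorphism. -/
@[simps]
def ofCrossed {G : Type*} [Group G] (α : G →* Rˣ) (β : G → R)
    (hβ : ∀ g h, β (g * h) = β g * α h + β h) : G →* RightAffine R where
  toFun g := ⟨α g, β g⟩
  map_one' := by
    have h := hβ 1 1
    ext <;> simp_all
  map_mul' g h := by ext <;> simp [hβ]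

/-- The linear part as a homomorphism. -/
@[simps]
def linearHom : RightAffine R →* Rˣ where
  toFun := linear
  map_one' := rfl
  map_mul' _ _ := rfl

lemma pow_of_translation_eq_zero {p : RightAffine R} (hp : p.translation = 0) (k : ℕ) :
    p ^ k = ⟨p.linear ^ k, 0⟩ := by
  induction k with
  | zero => rw [pow_zero, pow_zero]; rfl
  | succ k ih => rw [pow_succ, ih]; ext <;> simp [hp, pow_succ]

lemma zpow_of_linear_eq_one {p : RightAffine R} (hp : p.linear = 1) (m : ℤ) :
    p ^ m = ⟨1, m * p.translation⟩ := by
  induction m with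
  | zero => ext <;> simp
  | succ m ih => rw [zpow_add_one, ih]; ext <;> simp [hp]; ring
  | pred m ih => rw [zpow_sub_one, ih]; ext <;> simp [hp]; ring

end RightAffine

/-- Every element of a quotient of the triangle group `(2, 3, 6)`, generated by `a` and `b` with
`c = a * b⁻¹` of order dividing `6`, is a product of powers of the commuting translations
`a * c ^ 3` and `c * a * c ^ 2` and of the rotation `c`. -/
lemma triangleGroup_normal_form {Q : Type*} [Group Q] {a b c : Q} (ha : a ^ 2 = 1)
    (hb : b ^ 3 = 1) (hc : c ^ 6 = 1) (habc : c = a * b⁻¹)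
    (hgen : Subgroup.closure {a, b} = ⊤) (g : Q) :
    ∃ (m n : ℤ) (k : ℕ), g = (a * c ^ 3) ^ m * (c * a * c ^ 2) ^ n * c ^ k := by
  have haa : a * a = 1 := by rw [← sq, ha]
  have ha_inv : a⁻¹ = a := inv_eq_of_mul_eq_one_left haa
  have hbc : b = c⁻¹ * a := by rw [habc]; group
  have hc5 : c⁻¹ = c ^ 5 := inv_eq_of_mul_eq_one_left (by rw [← pow_succ, hc])
  have haca : a * c * a = c⁻¹ * a * c⁻¹ := by
    have h : c⁻¹ * a * (c⁻¹ * a) * (c⁻¹ * a) = 1 := by rw [← hbc, ← hb, pow_succ, sq]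
    calc a * c * a = (c⁻¹ * a)⁻¹ * a := by rw [mul_inv_rev, ha_inv, inv_inv]
      _ = c⁻¹ * a * (c⁻¹ * a) * a := by rw [eq_inv_of_mul_eq_one_left h]
      _ = c⁻¹ * a * c⁻¹ * (a * a) := by group
      _ = _ := by rw [haa, mul_one]
  have hacca : a * c ^ 2 * a = c⁻¹ * a * (c ^ 4) * a * c⁻¹ := by
    calc a * c ^ 2 * a = a * c * (a * a) * c * a := by rw [haa, mul_one, sq, mul_assoc a c c]
      _ = (a * c * a) * (a * c * a) := by group
      _ = c⁻¹ * a * (c⁻¹ * c⁻¹) * a * c⁻¹ := by rw [haca]; group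
      _ = c⁻¹ * a * (c ^ 6 * c⁻¹ * c⁻¹) * a * c⁻¹ := by rw [hc, one_mul]
      _ = _ := by group
  set x := a * c ^ 3 with hx
  set y := c * a * c ^ 2 with hy
  have hxy : Commute x y := by
    calc x * y = a * c ^ 4 * a * c ^ 2 := by rw [hx, hy]; group
      _ = c * (c⁻¹ * a * (c ^ 4) * a * c⁻¹) * c ^ 3 := by group
      _ = y * x := by rw [← hacca, hx, hy]; group
  have hcx : SemiconjBy c x y := by
    rw [SemiconjBy, hx, hy]; group
  have hcy : SemiconjBy c y (x⁻¹ * y) := by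
    calc c * y = c ^ 6 * c⁻¹ ^ 4 * a * c ^ 2 := by rw [hy, ← mul_assoc, ← mul_assoc, ← sq]; group
      _ = c⁻¹ ^ 3 * (c⁻¹ * a * c⁻¹) * c ^ 3 := by rw [hc]; group
      _ = c⁻¹ ^ 3 * a⁻¹ * c * a * c ^ 3 := by rw [← haca, ha_inv]; group
      _ = x⁻¹ * y * c := by rw [hx, hy]; group
  let P : Q → Prop := fun g => ∃ (m n : ℤ) (k : ℕ), g = x ^ m * y ^ n * c ^ k
  have hPc {g : Q} : P g → P (c * g) := by
    rintro ⟨m, n, k, rfl⟩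
    refine ⟨-n, m + n, k + 1, ?_⟩
    have h := ((hcx.zpow_right m).mul_right (hcy.zpow_right n)).eq
    rw [← mul_assoc, h, hxy.inv_left.mul_zpow, inv_zpow', ← mul_assoc,
      (hxy.symm.zpow_zpow m (-n)).eq, zpow_add, pow_succ']
    group
  have hPcpow {g : Q} (hg : P g) (j : ℕ) : P (c ^ j * g) := by
    induction j with
    | zero => simpa using hg
    | succ j ih => rw [pow_succ', mul_assoc]; exact hPc ih
  have hPa {g : Q} (hg : P g) : P (a * g) := by
    obtain ⟨m, n, k, h⟩ := hPcpow hg 3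
    refine ⟨1 + m, n, k, ?_⟩
    rw [zpow_add, zpow_one, mul_assoc, mul_assoc, ← mul_assoc (x ^ m), ← h, ← mul_assoc, hx,
      mul_assoc a, ← pow_add, hc, mul_one]
  have hg : g ∈ Subgroup.closure {a, b} := hgen ▸ Subgroup.mem_top g
  change P g
  induction hg using Subgroup.closure_induction_left with
  | one => exact ⟨0, 0, 0, by simp⟩
  | mul_left z hz g _ ih =>
    obtain rfl | rfl := hz
    · exact hPa ih
    · rw [hbc, hc5, mul_assoc]
      exact hPcpow (hPa ih) 5
  | inv_mul_cancel z hz g _ ih =>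
    obtain rfl | rfl := hz
    · rw [ha_inv]
      exact hPa ih
    · rw [hbc, mul_inv_rev, inv_inv, ha_inv, mul_assoc]
      exact hPa (hPc ih)

lemma tbar_sq : tbar ^ 2 = tbar - 1 := by
  have h : (Ideal.Quotient.mk _ (Polynomial.X ^ 2 - Polynomial.X + 1) : TrefoilRing) = 0 :=
    Ideal.Quotient.eq_zero_iff_mem.mpr (Ideal.subset_span rfl)
  simp only [map_add, map_sub, map_pow, map_one] at h
  rw [tbar]
  linear_combination h

lemma eq_zero_of_intCast_add_mul_tbar {p q : ℤ} (h : (p : TrefoilRing) + q * tbar = 0) :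
    p = 0 ∧ q = 0 := by
  have hmk : (Ideal.Quotient.mk _ (Polynomial.C q * Polynomial.X + Polynomial.C p) :
      TrefoilRing) = 0 := by
    rw [← h, tbar]
    simp [add_comm]
  rw [Ideal.Quotient.eq_zero_iff_mem, Ideal.mem_span_singleton] at hmk
  have hdeg : (Polynomial.X ^ 2 - Polynomial.X + 1 : Polynomial ℤ).degree = 2 := by
    compute_degree!
  have hzero := Polynomial.eq_zero_of_dvd_of_degree_lt hmk
    (Polynomial.degree_linear_le.trans_lt (by rw [hdeg]; decide))
  exact ⟨by simpa using congrArg (Polynomial.coeff · 0) hzero,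
    by simpa [-eq_intCast, Polynomial.coeff_C] using
      congrArg (Polynomial.coeff · 1) hzero⟩

lemma tbar_pow_six : tbar ^ 6 = 1 := by
  linear_combination (tbar ^ 4 + tbar ^ 3 - tbar - 1) * tbar_sq

lemma six_dvd_of_tbar_pow_eq_one {k : ℕ} (h : tbar ^ k = 1) : 6 ∣ k := by
  have hmod : tbar ^ (k % 6) = 1 := by
    rwa [← Nat.div_add_mod k 6, pow_add, pow_mul, tbar_pow_six, one_pow, one_mul] at h
  have hne {p q : ℤ} (hpq : ¬(p = 0 ∧ q = 0)) : (p : TrefoilRing) + q * tbar ≠ 0 :=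
    fun h => hpq (eq_zero_of_intCast_add_mul_tbar h)
  have hlt := Nat.mod_lt k (show 6 > 0 by decide)
  apply Nat.dvd_of_mod_eq_zero
  generalize k % 6 = r at hmod hlt
  interval_cases r
  · rfl
  · refine absurd ?_ (hne (p := -1) (q := 1) (by decide))
    push_cast
    linear_combination hmod
  · refine absurd ?_ (hne (p := -2) (q := 1) (by decide))
    push_cast
    linear_combination hmod - tbar_sq
  · refine absurd ?_ (hne (p := -2) (q := 0) (by decide))
    push_cast
    linear_combination hmod - (tbar + 1) * tbar_sq
  · refine absurd ?_ (hne (p := -1) (q := -1) (by decide))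
    push_cast
    linear_combination hmod - (tbar ^ 2 + tbar) * tbar_sq
  · refine absurd ?_ (hne (p := 0) (q := -1) (by decide))
    push_cast
    linear_combination hmod - (tbar ^ 3 + tbar ^ 2 - 1) * tbar_sq

/-- The unit `-t⁻¹ = t²`. -/
@[simps]
noncomputable def negTbarInv : TrefoilRingˣ where
  val := -(1 - tbar)
  inv := -tbar
  val_inv := by linear_combination -tbar_sq
  inv_val := by linear_combination -tbar_sq

/-- The images of the generators of the trefoil group in the affine group. -/
noncomputable def trefoilAffineGen : Fin 2 → RightAffine TrefoilRing :=
  ![⟨-1, 1⟩, ⟨negTbarInv, 1⟩]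

/-- The affine representation of the trefoil group. -/
noncomputable def trefoilAffine : TrefoilGroup14 →* RightAffine TrefoilRing :=
  PresentedGroup.toGroup (f := trefoilAffineGen) <| by
    rintro _ rfl
    rw [map_mul, map_inv, mul_inv_eq_one]
    simp only [trefoilAffineGen, pow_succ, pow_zero, one_mul]
    ext
    · simp
      linear_combination -(tbar - 2) * tbar_sq
    · simp
      linear_combination -tbar_sq

@[simp]
lemma trefoilAffine_of_zero : trefoilAffine (PresentedGroup.of 0) = ⟨-1, 1⟩ :=
  PresentedGroup.toGroup.of _

@[simp]
lemma trefoilAffine_of_one : trefoilAffine (PresentedGroup.of 1) = ⟨negTbarInv, 1⟩ :=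
  PresentedGroup.toGroup.of _

lemma ofCrossed_eq_trefoilAffine (α : TrefoilGroup14 →* TrefoilRingˣ)
    (β : TrefoilGroup14 → TrefoilRing) (hαa : (α (PresentedGroup.of 0) : TrefoilRing) = -1)
    (hαb : (α (PresentedGroup.of 1) : TrefoilRing) = -(1 - tbar))
    (hβ : ∀ g h, β (g * h) = β g * (α h : TrefoilRing) + β h)
    (hβa : β (PresentedGroup.of 0) = 1) (hβb : β (PresentedGroup.of 1) = 1) :
    RightAffine.ofCrossed α β hβ = trefoilAffine := by
  refine PresentedGroup.ext fun i => ?_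
  fin_cases i
  · ext <;> simp [hαa, hβa]
  · ext <;> simp [hαb, hβb]

lemma trefoilAffine_mul_inv :
    trefoilAffine (PresentedGroup.of 0 * (PresentedGroup.of 1)⁻¹) = ⟨-negTbarInv⁻¹, 0⟩ := by
  rw [map_mul, map_inv, trefoilAffine_of_zero, trefoilAffine_of_one]
  ext <;> simp

lemma val_neg_negTbarInv_inv : ((-negTbarInv⁻¹ : TrefoilRingˣ) : TrefoilRing) = tbar := by
  simp

lemma closure_trefoil_generators :
    Subgroup.closure {PresentedGroup.of 0, PresentedGroup.of 1} =
      (⊤ : Subgroup TrefoilGroup14) := by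
  rw [← PresentedGroup.closure_range_of trefoilRels14]
  congr 1
  ext g
  simp [Fin.exists_fin_two, eq_comm]

lemma ker_trefoilAffine :
    trefoilAffine.ker = Subgroup.normalClosure
      {PresentedGroup.of 0 ^ 2, (PresentedGroup.of 0 * (PresentedGroup.of 1)⁻¹) ^ 6} := by
  set a : TrefoilGroup14 := PresentedGroup.of 0
  set b : TrefoilGroup14 := PresentedGroup.of 1
  set N := Subgroup.normalClosure {a ^ 2, (a * b⁻¹) ^ 6}
  have hu : (-negTbarInv⁻¹ : TrefoilRingˣ) ^ 6 = 1 := by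
    ext
    rw [Units.val_pow_eq_pow_val, val_neg_negTbarInv_inv, tbar_pow_six, Units.val_one]
  have hle : N ≤ trefoilAffine.ker := by
    refine Subgroup.normalClosure_le_normal ?_
    rintro _ (rfl | rfl)
    · rw [SetLike.mem_coe, MonoidHom.mem_ker, map_pow, trefoilAffine_of_zero,
        sq (_ : RightAffine TrefoilRing)]
      ext <;> simp
    · rw [SetLike.mem_coe, MonoidHom.mem_ker, map_pow, trefoilAffine_mul_inv,
        RightAffine.pow_of_translation_eq_zero rfl, hu]
      rfl
  refine le_antisymm (fun g hg => ?_) hle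
  have hrel : a ^ 2 = b ^ 3 := by
    have h := PresentedGroup.one_of_mem (rels := trefoilRels14) rfl
    rwa [map_mul, map_inv, map_pow, map_pow, mul_inv_eq_one] at h
  have hmem_sq : a ^ 2 ∈ N := Subgroup.subset_normalClosure (Or.inl rfl)
  have hmem_six : (a * b⁻¹) ^ 6 ∈ N := Subgroup.subset_normalClosure (Or.inr rfl)
  let π := QuotientGroup.mk' N
  have hπ {z : TrefoilGroup14} (hz : z ∈ N) : π z = 1 := (QuotientGroup.eq_one_iff z).mpr hz
  have hgen : Subgroup.closure {π a, π b} = ⊤ := by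
    rw [← Set.image_pair, ← MonoidHom.map_closure, closure_trefoil_generators,
      Subgroup.map_top_of_surjective _ (QuotientGroup.mk'_surjective N)]
  obtain ⟨m, n, k, h⟩ := triangleGroup_normal_form (a := π a) (b := π b) (c := π (a * b⁻¹))
    (by rw [← map_pow, hπ hmem_sq]) (by rw [← map_pow, ← hrel, hπ hmem_sq])
    (by rw [← map_pow, hπ hmem_six]) (by rw [map_mul, map_inv]) hgen (π g)
  set c := a * b⁻¹
  simp only [← map_pow, ← map_mul, ← map_zpow] at h
  have hdiff := hle (QuotientGroup.eq.mp h)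
  rw [MonoidHom.mem_ker] at hg
  rw [MonoidHom.mem_ker, map_mul, map_inv, hg, inv_one, one_mul] at hdiff
  have hx : trefoilAffine (a * c ^ 3) = ⟨1, -1⟩ := by
    rw [map_mul, map_pow, trefoilAffine_mul_inv, trefoilAffine_of_zero,
      RightAffine.pow_of_translation_eq_zero rfl]
    ext
    · simp
      linear_combination -(tbar + 1) * tbar_sq
    · simp
      linear_combination (tbar + 1) * tbar_sq
  have hy : trefoilAffine (c * a * c ^ 2) = ⟨1, tbar - 1⟩ := by
    rw [map_mul, map_mul, map_pow, trefoilAffine_mul_inv, trefoilAffine_of_zero,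
      RightAffine.pow_of_translation_eq_zero rfl]
    ext
    · simp
      linear_combination -(tbar + 1) * tbar_sq
    · simp
      linear_combination tbar_sq
  rw [map_mul, map_mul, map_zpow, map_zpow, map_pow, hx, hy, trefoilAffine_mul_inv,
    RightAffine.pow_of_translation_eq_zero rfl, RightAffine.zpow_of_linear_eq_one rfl,
    RightAffine.zpow_of_linear_eq_one rfl, RightAffine.ext_iff] at hdiff
  obtain ⟨hlin, htrans⟩ := hdiff
  simp only [RightAffine.mul_linear, RightAffine.one_linear, one_mul] at hlin
  simp only [RightAffine.mul_translation, RightAffine.one_translation, hlin, Units.val_one,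
    mul_one, add_zero] at htrans
  obtain ⟨hmn, rfl⟩ := eq_zero_of_intCast_add_mul_tbar (p := -m - n) (q := n) (by
    push_cast
    linear_combination htrans)
  obtain rfl : m = 0 := by omega
  obtain ⟨j, rfl⟩ := six_dvd_of_tbar_pow_eq_one (k := k) (by
    rw [← val_neg_negTbarInv_inv, ← Units.val_pow_eq_pow_val, hlin, Units.val_one])
  rw [← QuotientGroup.eq_one_iff]
  change π g = 1
  rw [h, zpow_zero, zpow_zero, one_mul, one_mul, pow_mul, map_pow, hπ hmem_six, one_pow]

/-- Let `G = ⟨a, b | a² = b³⟩` be the trefoil knot group and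
`R = ℤ[t]/(t² - t + 1)` (so `t` is a unit with `t⁻¹ = 1 - t`).  Then:
(1) there is a unique pair consisting of a group homomorphism `α : G →* Rˣ` with
`α a = -1`, `α b = -t⁻¹ = -(1 - t)` and a map `β : G → R` with
`β (g*h) = β g * α h + β h` and `β a = β b = 1`; and
(2) for any such pair, the subgroup `{g | α g = 1 ∧ β g = 0}` equals the normal closure
in `G` of `{a², (a*b⁻¹)⁶}`. -/
theorem trefoil_representation_kernel :
    (∃! p : (TrefoilGroup14 →* TrefoilRingˣ) × (TrefoilGroup14 → TrefoilRing),
      ((p.1 (PresentedGroup.of 0) : TrefoilRing) = -1) ∧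
      ((p.1 (PresentedGroup.of 1) : TrefoilRing) = -(1 - tbar)) ∧
      (∀ g h : TrefoilGroup14, p.2 (g * h) = p.2 g * (p.1 h : TrefoilRing) + p.2 h) ∧
      p.2 (PresentedGroup.of 0) = 1 ∧ p.2 (PresentedGroup.of 1) = 1) ∧
    (∀ (α : TrefoilGroup14 →* TrefoilRingˣ) (β : TrefoilGroup14 → TrefoilRing),
      ((α (PresentedGroup.of 0) : TrefoilRing) = -1) →
      ((α (PresentedGroup.of 1) : TrefoilRing) = -(1 - tbar)) →
      (∀ g h : TrefoilGroup14, β (g * h) = β g * (α h : TrefoilRing) + β h) →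
      β (PresentedGroup.of 0) = 1 → β (PresentedGroup.of 1) = 1 →
      {g : TrefoilGroup14 | α g = 1 ∧ β g = 0} =
        ↑(Subgroup.normalClosure
          ({PresentedGroup.of 0 ^ 2,
            (PresentedGroup.of 0 * (PresentedGroup.of 1)⁻¹) ^ 6} : Set TrefoilGroup14))) := by
  refine ⟨⟨⟨RightAffine.linearHom.comp trefoilAffine, fun g => (trefoilAffine g).translation⟩,
    ⟨by simp, by simp, by simp, by simp, by simp⟩, ?_⟩, ?_⟩
  · rintro ⟨α, β⟩ ⟨hαa, hαb, hβ, hβa, hβb⟩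
    rw [← ofCrossed_eq_trefoilAffine α β hαa hαb hβ hβa hβb]
    rfl
  · intro α β hαa hαb hβ hβa hβb
    rw [← ker_trefoilAffine, ← ofCrossed_eq_trefoilAffine α β hαa hαb hβ hβa hβb]
    ext g
    simp [MonoidHom.mem_ker, RightAffine.ext_iff]
end

section
/- Let G = ⟨a1, a2 | a1·w = w·a2⟩ with w = a2⁻¹·a1·a2·a1⁻¹ be the figure-eight knot group, and let H be the subgroup of G generated by a1 and w·w̄, where w̄ = a1⁻¹·a2·a1·a2⁻¹. Let R be a nontrivial ring, α : G → Rˣ a group homomorphism, and β : G → R with β(g·h) = β(g)·α(h) + β(h) for all g, h ∈ G. Assume: β(h) = 0 for all h ∈ H; for every g ∈ G, β(g) is either zero or invertible; and β(a2) = 1. Writing x1 = α(a1) and x2 = α(a2) (as elements of R), the following hold: x1⁻¹·x2 + x2·x1⁻¹ = x1⁻¹ + x2 − 1, x2⁻¹·x1 + x1·x2⁻¹ = x2⁻¹ + x1 − 1, and x2·(1 − x2) = (1 − x1)·x1. -/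
/-- The word `w = a₂⁻¹ a₁ a₂ a₁⁻¹` in the free group on two generators (`0 ↦ a₁`, `1 ↦ a₂`). -/
def fig8w : FreeGroup (Fin 2) :=
  (FreeGroup.of 1)⁻¹ * FreeGroup.of 0 * FreeGroup.of 1 * (FreeGroup.of 0)⁻¹

/-- The single relator `a₁ w a₂⁻¹ w⁻¹` of the figure-eight knot group
`G = ⟨a₁, a₂ | a₁ w = w a₂⟩`. -/
def fig8Rels : Set (FreeGroup (Fin 2)) :=
  {FreeGroup.of 0 * fig8w * (FreeGroup.of 1)⁻¹ * fig8w⁻¹}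

/-- The figure-eight knot group. -/
abbrev Fig8Group := PresentedGroup fig8Rels

/-- The image of `a₁` in the figure-eight knot group. -/
def fig8a1 : Fig8Group := PresentedGroup.of 0

/-- The image of `a₂` in the figure-eight knot group. -/
def fig8a2 : Fig8Group := PresentedGroup.of 1

/-- The image of `w = a₂⁻¹ a₁ a₂ a₁⁻¹` in the figure-eight knot group. -/
def fig8wbar : Fig8Group := fig8a2⁻¹ * fig8a1 * fig8a2 * fig8a1⁻¹

/-- The image of `w̄ = a₁⁻¹ a₂ a₁ a₂⁻¹` in the figure-eight knot group. -/
def fig8wbar' : Fig8Group := fig8a1⁻¹ * fig8a2 * fig8a1 * fig8a2⁻¹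

/-- The defining relation `a₁ w = w a₂` of the figure-eight knot group. -/
theorem fig8a1_mul_fig8wbar : fig8a1 * fig8wbar = fig8wbar * fig8a2 := by
  have h : PresentedGroup.mk fig8Rels
      (FreeGroup.of 0 * fig8w * (FreeGroup.of 1)⁻¹ * fig8w⁻¹) = 1 :=
    PresentedGroup.one_of_mem rfl
  rw [map_mul, map_mul, map_mul, map_inv, map_inv, mul_inv_eq_one, mul_inv_eq_iff_eq_mul] at h
  simp only [fig8w, map_mul, map_inv] at h
  exact h

/-- Multiplying `x v + v x = x + x v x - x²` by `x⁻¹` on both sides. -/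
theorem Units.inv_mul_add_mul_inv_eq {R : Type*} [Ring R] (x : Rˣ) (v : R)
    (h : x * v + v * x = x + x * v * x - x * x) :
    (↑x⁻¹ : R) * v + v * ↑x⁻¹ = ↑x⁻¹ + v - 1 := by
  have h' := congrArg (fun t : R => ↑x⁻¹ * t * ↑x⁻¹) h
  simp only [mul_add, mul_sub, add_mul, sub_mul, mul_assoc, Units.inv_mul_cancel_left,
    Units.mul_inv, Units.inv_mul, mul_one, one_mul] at h'
  rw [add_comm, h']

/-- Let `G = ⟨a₁, a₂ | a₁ w = w a₂⟩`, `w = a₂⁻¹a₁a₂a₁⁻¹`, be the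
figure-eight knot group and `H = ⟨a₁, w w̄⟩` its peripheral subgroup, `w̄ = a₁⁻¹a₂a₁a₂⁻¹`.
Let `R` be a nontrivial ring, `α : G →* Rˣ` a homomorphism and `β : G → R` with
`β (g*h) = β g * α h + β h`.  Assume `β` vanishes on `H`, every `β g` is zero or invertible,
and `β a₂ = 1`.  Writing `x₁ = α a₁`, `x₂ = α a₂` (as elements of `R`), one has
`x₁⁻¹x₂ + x₂x₁⁻¹ = x₁⁻¹ + x₂ - 1`, `x₂⁻¹x₁ + x₁x₂⁻¹ = x₂⁻¹ + x₁ - 1` and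
`x₂(1 - x₂) = (1 - x₁)x₁`. -/
theorem fig8_weakly_special {R : Type*} [Ring R] [Nontrivial R]
    (α : Fig8Group →* Rˣ) (β : Fig8Group → R)
    (hβ : ∀ g h : Fig8Group, β (g * h) = β g * (α h : R) + β h)
    (hH : ∀ h ∈ Subgroup.closure ({fig8a1, fig8wbar * fig8wbar'} : Set Fig8Group), β h = 0)
    (hzu : ∀ g : Fig8Group, β g = 0 ∨ IsUnit (β g))
    (hb : β fig8a2 = 1) :
    ((α fig8a1)⁻¹ : Rˣ) * ((α fig8a2 : Rˣ) : R) + (α fig8a2 : Rˣ) * (((α fig8a1)⁻¹ : Rˣ) : R)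
        = (((α fig8a1)⁻¹ : Rˣ) : R) + (α fig8a2 : Rˣ) - 1 ∧
    ((α fig8a2)⁻¹ : Rˣ) * ((α fig8a1 : Rˣ) : R) + (α fig8a1 : Rˣ) * (((α fig8a2)⁻¹ : Rˣ) : R)
        = (((α fig8a2)⁻¹ : Rˣ) : R) + (α fig8a1 : Rˣ) - 1 ∧
    ((α fig8a2 : Rˣ) : R) * (1 - ((α fig8a2 : Rˣ) : R))
        = (1 - ((α fig8a1 : Rˣ) : R)) * ((α fig8a1 : Rˣ) : R) := by
  set x := α fig8a1
  set y := α fig8a2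
  set b := β fig8wbar with hb_def
  have hβ_one : β 1 = 0 := hH 1 (one_mem _)
  have hβ_inv (g : Fig8Group) : β g⁻¹ = -(β g * ↑(α g)⁻¹) := by
    have h := hβ g g⁻¹
    rw [mul_inv_cancel, hβ_one, map_inv] at h
    exact eq_neg_of_add_eq_zero_right h.symm
  have hβ_a1 : β fig8a1 = 0 := hH _ (Subgroup.subset_closure (by simp))
  have hβ_w : b = ↑x⁻¹ - ↑y⁻¹ * x * y * ↑x⁻¹ := by
    simp only [hb_def, fig8wbar, hβ, hβ_inv, hb, hβ_a1, map_inv]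
    noncomm_ring
  have hα_w : (α fig8wbar : R) = ↑y⁻¹ * x * y * ↑x⁻¹ := by
    simp [fig8wbar, x, y]
  have hb_right : b * (1 - y) = 1 := by
    have h := congrArg β fig8a1_mul_fig8wbar
    rw [hβ, hβ, hβ_a1, hb, zero_mul, zero_add] at h
    rw [mul_sub, mul_one, sub_eq_iff_eq_add, add_comm]
    exact h
  have hb_unit : IsUnit b := (hzu fig8wbar).resolve_left fun h => by
    rw [← hb_def] at h
    simp [h] at hb_right
  have hb_left : (1 - (y : R)) * b = 1 := by
    obtain ⟨u, hu⟩ := hb_unit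
    rw [← hu] at hb_right ⊢
    rw [Units.eq_inv_of_mul_eq_one_left hb_right, Units.inv_mul]
  -- `β (w w̄) = 0` gives `b x⁻¹ y x = 1 - x`
  have hlong : b * ↑x⁻¹ * y * x = 1 - x := by
    have h := hH (fig8wbar * fig8wbar') (Subgroup.subset_closure (by simp))
    have hw' : β fig8wbar' = (x - 1) * ↑y⁻¹ := by
      simp only [fig8wbar', hβ, hβ_inv, hb, hβ_a1, map_inv]
      noncomm_ring
    have hα_w' : (α fig8wbar' : R) = ↑x⁻¹ * y * x * ↑y⁻¹ := by
      simp [fig8wbar', x, y]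
    rw [hβ, hw', hα_w', ← hb_def] at h
    have h' := congrArg (· * (y : R)) h
    simp only [add_mul, mul_assoc, Units.inv_mul, mul_one, zero_mul] at h'
    rw [eq_neg_of_add_eq_zero_left (a := b * ↑x⁻¹ * y * x) (b := (x : R) - 1)
      (by simpa only [mul_assoc] using h'), neg_sub]
  have hyx : (y : R) * x = x * (1 - y) * (1 - x) := by
    have h := congrArg (fun t : R => x * ((1 - y) * t)) hlong
    simp only [← mul_assoc] at h
    rw [mul_assoc (x : R) (1 - y) b, hb_left, mul_one, Units.mul_inv, one_mul] at h
    exact h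
  have hbx : b * x = 1 - ↑y⁻¹ * x * y := by
    rw [hβ_w, sub_mul, Units.inv_mul, Units.inv_mul_cancel_right]
  have hx : (x : R) = (1 - y) * (1 - ↑y⁻¹ * x * y) := by
    rw [← hbx, ← mul_assoc, hb_left, one_mul]
  have hxy : (y : R) * x + x * y = y + y * x * y - y * y := by
    have h := congrArg (fun t : R => y * t) hx
    simp only [mul_sub, sub_mul, mul_assoc, one_mul, mul_one, Units.mul_inv_cancel_left] at h
    rw [mul_assoc (y : R) x y, h]
    abel
  refine ⟨x.inv_mul_add_mul_inv_eq y ?_, y.inv_mul_add_mul_inv_eq x ?_, ?_⟩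
  · rw [hyx]; noncomm_ring
  · exact hxy
  · have hrel : (x : R) * α fig8wbar = α fig8wbar * y := by
      simpa using congrArg (fun g => (α g : R)) fig8a1_mul_fig8wbar
    have hα_w' : (α fig8wbar : R) = ↑x⁻¹ - b := by rw [hα_w, hβ_w, sub_sub_cancel]
    rw [hα_w', mul_sub, sub_mul, Units.mul_inv] at hrel
    have hby : b * y = b - 1 := by
      rw [← hb_right]; noncomm_ring
    have h : (1 - (x : R)) * b = ↑x⁻¹ * y := by
      rw [hby] at hrel
      rw [sub_mul, one_mul, ← sub_eq_zero]
      rw [← sub_eq_zero] at hrel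
      rw [← hrel]; abel
    have h' : (1 - (x : R)) = ↑x⁻¹ * y * (1 - y) := by
      rw [← h, mul_assoc, hb_right, mul_one]
    have h'' : (x : R) * (1 - x) = y * (1 - y) := by
      rw [h', mul_assoc, Units.mul_inv_cancel_left]
    rw [← h'']; noncomm_ring
end

section
/- Let R be a ring and let x1, x2, z ∈ R be invertible elements satisfying: x1⁻¹·x2 + x2·x1⁻¹ = x1⁻¹ + x2 − 1; x2⁻¹·x1 + x1·x2⁻¹ = x2⁻¹ + x1 − 1; x1 − x1² = z; and x2 − x2² = z. Set r = x2 − x1. Then: (z − 1)·r = 0; z·x1 + 1 = 3·z + x1 + r²; and 2·r² + z² + 4·z − 1 = 0. -/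
/-- If `a - a ^ 2 = z` with `a` invertible and `z` commuting with `b`, then multiplying the
relation `a⁻¹ * b + b * a⁻¹ = a⁻¹ + b - 1` by `z` eliminates `a⁻¹`. -/
theorem eliminate_inv_of_sub_sq_eq {R : Type*} [Ring R] (a : Rˣ) (b z : R)
    (h : (↑a⁻¹ : R) * b + b * ↑a⁻¹ = (↑a⁻¹ : R) + b - 1)
    (ha : (a : R) - (a : R) ^ 2 = z) (hb : z * b = b * z) :
    (1 - (a : R)) * b + b * (1 - a) = (1 - a) + z * b - z := by
  have hz : z * (↑a⁻¹ : R) = 1 - a := by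
    rw [← ha, sub_mul, sq, mul_assoc, Units.mul_inv, mul_one]
  calc (1 - (a : R)) * b + b * (1 - a) = z * ((↑a⁻¹ : R) * b + b * ↑a⁻¹) := by
        rw [mul_add, ← mul_assoc, ← mul_assoc, hb, mul_assoc b, hz]
    _ = (1 - a) + z * b - z := by rw [h, mul_sub, mul_add, hz, mul_one]

/-- Let `R` be a ring and `x₁ x₂ z` invertible elements of `R` satisfying the
anticommutation relations `x₁⁻¹*x₂ + x₂*x₁⁻¹ = x₁⁻¹ + x₂ - 1`,
`x₂⁻¹*x₁ + x₁*x₂⁻¹ = x₂⁻¹ + x₁ - 1`, and `x₁ - x₁² = z = x₂ - x₂²`.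
Set `r = x₂ - x₁`.  Then `(z - 1)*r = 0`, `z*x₁ + 1 = 3*z + x₁ + r²` and
`2*r² + z² + 4*z - 1 = 0`. -/
theorem figure_eight_relations {R : Type*} [Ring R] (x₁ x₂ z : Rˣ)
    (h1 : (↑x₁⁻¹ : R) * x₂ + (x₂ : R) * ↑x₁⁻¹ = (↑x₁⁻¹ : R) + x₂ - 1)
    (h2 : (↑x₂⁻¹ : R) * x₁ + (x₁ : R) * ↑x₂⁻¹ = (↑x₂⁻¹ : R) + x₁ - 1)
    (h3 : (x₁ : R) - (x₁ : R) ^ 2 = z)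
    (h4 : (x₂ : R) - (x₂ : R) ^ 2 = z) :
    ((z : R) - 1) * ((x₂ : R) - x₁) = 0 ∧
    (z : R) * x₁ + 1 = 3 * z + x₁ + ((x₂ : R) - x₁) ^ 2 ∧
    2 * ((x₂ : R) - x₁) ^ 2 + (z : R) ^ 2 + 4 * z - 1 = 0 := by
  have hz₁ : (z : R) * x₁ = x₁ * z := by rw [← h3]; noncomm_ring
  have hz₂ : (z : R) * x₂ = x₂ * z := by rw [← h4]; noncomm_ring
  have e₁ := eliminate_inv_of_sub_sq_eq x₁ x₂ z h1 h3 hz₂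
  have e₂ := eliminate_inv_of_sub_sq_eq x₂ x₁ z h2 h4 hz₁
  have hzr : ((z : R) - 1) * ((x₂ : R) - x₁) = 0 := by
    linear_combination (norm := noncomm_ring) e₂ - e₁
  have hrel : (z : R) * x₁ + 1 = 3 * z + x₁ + ((x₂ : R) - x₁) ^ 2 := by
    linear_combination (norm := noncomm_ring) h3 + h4 - e₂
  refine ⟨hzr, hrel, ?_⟩
  generalize hr : (x₂ : R) - x₁ = r at hzr hrel ⊢
  have hrz' : r * ((z : R) - 1) = 0 := by
    rw [← hzr, ← hr]
    linear_combination (norm := noncomm_ring) hz₁ - hz₂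
  have hrz : r * (z : R) = r := by linear_combination (norm := noncomm_ring) hrz'
  have hx : ((z : R) - 1) * x₁ = r ^ 2 + 3 * z - 1 := by
    linear_combination (norm := noncomm_ring) hrel
  have hcube : r * r ^ 2 = -2 * r := by
    have h : r * (r ^ 2 + 3 * z - 1) = 0 := by rw [← hx, ← mul_assoc, hrz', zero_mul]
    linear_combination (norm := noncomm_ring) h - 3 * hrz
  have hfour : r ^ 2 * r ^ 2 = -2 * r ^ 2 := by
    linear_combination (norm := noncomm_ring) r * hcube
  have hsz : r ^ 2 * (z : R) = r ^ 2 := by rw [sq, mul_assoc, hrz]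
  have hquad : (r ^ 2 + 3 * (z : R) - 1) * (r ^ 2 + 3 * z - 1) =
      (z - 1) * (r ^ 2 + 3 * z - 1) - (z - 1) * (z - 1) * z := by
    rw [← hx, ← h3]
    noncomm_ring
  rw [← z.mul_right_eq_zero]
  linear_combination (norm := noncomm_ring) hquad - hfour - 3 * hsz
end

section
/- Let Γ = SL(2, ℤ), let Z be its center (consisting of ±identity), and let P = Γ/Z be the projective modular group PSL(2, ℤ). Let B ≤ Γ be the subgroup of upper-triangular matrices (those with lower-left entry 0) and let B̄ be its image in P. Then B̄ is malnormal in P: for every p ∈ P, if there exists q ∈ B̄ with q ≠ 1 and p·q·p⁻¹ ∈ B̄, then p ∈ B̄. -/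
open Matrix

/-- The subgroup of upper-triangular matrices (lower-left entry `0`) in `SL(2, ℤ)`. -/
def upperTriangularSL2Z : Subgroup (Matrix.SpecialLinearGroup (Fin 2) ℤ) where
  carrier := {A | (A : Matrix (Fin 2) (Fin 2) ℤ) 1 0 = 0}
  one_mem' := by simp
  mul_mem' := by
    intro A B hA hB
    simp only [Set.mem_setOf_eq, Matrix.SpecialLinearGroup.coe_mul, Matrix.mul_apply,
      Fin.sum_univ_two] at *
    rw [hA, hB]
    ring
  inv_mem' := by
    intro A hA
    simp only [Set.mem_setOf_eq] at *
    rw [Matrix.SpecialLinearGroup.SL2_inv_expl]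
    simp [hA]

/-- The image of the upper-triangular subgroup in `PSL(2, ℤ) = SL(2, ℤ)/center`. -/
def upperTriangularPSL2Z :
    Subgroup (Matrix.SpecialLinearGroup (Fin 2) ℤ ⧸
      Subgroup.center (Matrix.SpecialLinearGroup (Fin 2) ℤ)) :=
  upperTriangularSL2Z.map
    (QuotientGroup.mk' (Subgroup.center (Matrix.SpecialLinearGroup (Fin 2) ℤ)))

open scoped MatrixGroups

theorem mem_upperTriangularSL2Z {A : SL(2, ℤ)} : A ∈ upperTriangularSL2Z ↔ A 1 0 = 0 :=
  Iff.rfl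

theorem center_le_upperTriangularSL2Z : Subgroup.center SL(2, ℤ) ≤ upperTriangularSL2Z := by
  intro A hA
  obtain ⟨r, -, hr⟩ := Matrix.SpecialLinearGroup.mem_center_iff.mp hA
  rw [mem_upperTriangularSL2Z, ← hr, Matrix.scalar_apply, Matrix.diagonal_apply_ne _ one_ne_zero]

theorem mk_mem_upperTriangularPSL2Z {A : SL(2, ℤ)} :
    (A : SL(2, ℤ) ⧸ Subgroup.center SL(2, ℤ)) ∈ upperTriangularPSL2Z ↔
      A ∈ upperTriangularSL2Z := by
  change A ∈ (upperTriangularSL2Z.map (QuotientGroup.mk' _)).comap (QuotientGroup.mk' _) ↔ _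
  rw [Subgroup.comap_map_eq_self]
  simpa using center_le_upperTriangularSL2Z

theorem diag_eq_of_mem_upperTriangularSL2Z {B : SL(2, ℤ)} (hB : B ∈ upperTriangularSL2Z) :
    B 0 0 = B 1 1 := by
  have hdet := B.det_coe
  rw [Matrix.det_fin_two, mem_upperTriangularSL2Z.mp hB, mul_zero, sub_zero] at hdet
  exact Int.eq_of_mul_eq_one hdet

theorem mem_center_of_mem_upperTriangularSL2Z {B : SL(2, ℤ)} (hB : B ∈ upperTriangularSL2Z)
    (h : B 0 1 = 0) : B ∈ Subgroup.center SL(2, ℤ) := by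
  have hdiag := diag_eq_of_mem_upperTriangularSL2Z hB
  have hdet := B.det_coe
  rw [mem_upperTriangularSL2Z] at hB
  rw [Matrix.det_fin_two] at hdet
  refine Matrix.SpecialLinearGroup.mem_center_iff.mpr ⟨B 0 0, ?_, ?_⟩
  · rw [Fintype.card_fin, sq]
    simpa [hB, ← hdiag] using hdet
  · rw [Matrix.scalar_apply]
    ext i j
    fin_cases i <;> fin_cases j <;> simp [hB, h, hdiag]

theorem conj_apply_one_zero (A : SL(2, ℤ)) {B : SL(2, ℤ)} (hB : B ∈ upperTriangularSL2Z) :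
    (A * B * A⁻¹) 1 0 = -(A 1 0 ^ 2 * B 0 1) := by
  have hdiag := diag_eq_of_mem_upperTriangularSL2Z hB
  rw [mem_upperTriangularSL2Z] at hB
  simp only [Matrix.SpecialLinearGroup.coe_mul, Matrix.SpecialLinearGroup.coe_inv,
    Matrix.adjugate_fin_two, Matrix.mul_apply, Fin.sum_univ_two]
  simp [hB, hdiag]
  ring

/-- Let `P = PSL(2, ℤ)` be the quotient of `SL(2, ℤ)` by its center and let
`B̄` be the image in `P` of the subgroup of upper-triangular matrices of `SL(2, ℤ)`.  Then `B̄`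
is malnormal in `P`: for every `p ∈ P`, if there is `q ∈ B̄` with `q ≠ 1` and `p*q*p⁻¹ ∈ B̄`,
then `p ∈ B̄`. -/
theorem upperTriangular_malnormal_PSL2Z :
    ∀ p : Matrix.SpecialLinearGroup (Fin 2) ℤ ⧸
        Subgroup.center (Matrix.SpecialLinearGroup (Fin 2) ℤ),
      (∃ q, q ∈ upperTriangularPSL2Z ∧ q ≠ 1 ∧ p * q * p⁻¹ ∈ upperTriangularPSL2Z) →
      p ∈ upperTriangularPSL2Z := by
  rintro ⟨A⟩ ⟨⟨B⟩, hB, hne, hconj⟩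
  change ((A * B * A⁻¹ : SL(2, ℤ)) : SL(2, ℤ) ⧸ Subgroup.center SL(2, ℤ)) ∈ _ at hconj
  replace hB := mk_mem_upperTriangularPSL2Z.mp hB
  rw [mk_mem_upperTriangularPSL2Z, mem_upperTriangularSL2Z, conj_apply_one_zero A hB,
    neg_eq_zero, mul_eq_zero] at hconj
  rcases hconj with h | h
  · exact mk_mem_upperTriangularPSL2Z.mpr (pow_eq_zero_iff two_ne_zero |>.mp h)
  · exact absurd ((QuotientGroup.eq_one_iff B).mpr
      (mem_center_of_mem_upperTriangularSL2Z hB h)) hne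
end

section
/- For i ∈ ℕ let σ_i denote the transposition of i and i+1 in the group of permutations of ℕ, and let S∞ be the subgroup of permutations of ℕ generated by { σ_i | i ∈ ℕ } (the finitary symmetric group). Then there exists a unique family of set-theoretic maps δ_i : S∞ → S∞ (i ∈ ℕ) such that: (a) for all i, m ∈ ℕ, δ_i(σ_m) equals σ_{m−1} if i < m, equals the identity if i = m or i = m+1, and equals σ_m if i > m+1; and (b) δ_i(g·h) = δ_i(g)·δ_{g⁻¹(i)}(h) for all g, h ∈ S∞ and all i ∈ ℕ. (In particular δ_i(1) = 1 for all i.) -/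
/-- The finitary symmetric group `S∞`: the subgroup of permutations of `ℕ` generated by the
transpositions `σᵢ = (i, i+1)`. -/
def Sinfty : Subgroup (Equiv.Perm ℕ) :=
  Subgroup.closure (Set.range fun i : ℕ => Equiv.swap i (i + 1))

/-- The transposition `σᵢ = (i, i+1)` as an element of `S∞`. -/
def sigmaS (i : ℕ) : Sinfty :=
  ⟨Equiv.swap i (i + 1), Subgroup.subset_closure ⟨i, rfl⟩⟩

open Equiv

/-- The order embedding of `ℕ` into itself whose range omits exactly `i`. -/
def skip (i k : ℕ) : ℕ := if k < i then k else k + 1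

/-- The inverse of `skip i` on the complement of `i`. -/
def unskip (i k : ℕ) : ℕ := if k < i then k else k - 1

lemma skip_ne (i k : ℕ) : skip i k ≠ i := by
  unfold skip; split_ifs <;> omega

lemma unskip_skip (i k : ℕ) : unskip i (skip i k) = k := by
  unfold unskip skip; split_ifs <;> omega

lemma skip_unskip {i k : ℕ} (h : k ≠ i) : skip i (unskip i k) = k := by
  unfold unskip skip; split_ifs <;> omega

lemma apply_skip_ne (g : Perm ℕ) (i k : ℕ) : g (skip (g⁻¹ i) k) ≠ i := by
  intro h
  exact skip_ne (g⁻¹ i) k (Perm.eq_inv_iff_eq.2 h)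

lemma inv_apply_skip_ne (g : Perm ℕ) (i k : ℕ) : g⁻¹ (skip i k) ≠ g⁻¹ i :=
  fun h => skip_ne i k (g⁻¹.injective h)

/-- The permutation obtained from `g` by deleting the value `i` (and its preimage) and
relabelling the remaining integers in increasing order. -/
def deleteValue (i : ℕ) (g : Perm ℕ) : Perm ℕ where
  toFun k := unskip i (g (skip (g⁻¹ i) k))
  invFun k := unskip (g⁻¹ i) (g⁻¹ (skip i k))
  left_inv k := by
    dsimp only
    rw [skip_unskip (apply_skip_ne g i k), ← Perm.mul_apply, inv_mul_cancel, Perm.one_apply,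
      unskip_skip]
  right_inv k := by
    dsimp only
    rw [skip_unskip (inv_apply_skip_ne g i k), ← Perm.mul_apply, mul_inv_cancel, Perm.one_apply,
      unskip_skip]

lemma deleteValue_apply (i : ℕ) (g : Perm ℕ) (k : ℕ) :
    deleteValue i g k = unskip i (g (skip (g⁻¹ i) k)) := rfl

lemma deleteValue_mul (i : ℕ) (g h : Perm ℕ) :
    deleteValue i (g * h) = deleteValue i g * deleteValue (g⁻¹ i) h := by
  ext k
  simp only [deleteValue_apply, Perm.mul_apply, mul_inv_rev]
  rw [skip_unskip (apply_skip_ne h (g⁻¹ i) k)]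

lemma deleteValue_one (i : ℕ) : deleteValue i 1 = 1 := by
  ext k
  simp [deleteValue_apply, unskip_skip]

lemma deleteValue_swap_of_lt {i m : ℕ} (h : i < m) :
    deleteValue i (swap m (m + 1)) = swap (m - 1) (m - 1 + 1) := by
  ext k
  simp only [deleteValue_apply, swap_inv, swap_apply_def, skip, unskip]
  grind

lemma deleteValue_swap_of_eq {i m : ℕ} (h : i = m ∨ i = m + 1) :
    deleteValue i (swap m (m + 1)) = 1 := by
  ext k
  simp only [deleteValue_apply, swap_inv, swap_apply_def, skip, unskip, Perm.one_apply]
  grind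

lemma deleteValue_swap_of_gt {i m : ℕ} (h : m + 1 < i) :
    deleteValue i (swap m (m + 1)) = swap m (m + 1) := by
  ext k
  simp only [deleteValue_apply, swap_inv, swap_apply_def, skip, unskip]
  grind

lemma deleteValue_mem_Sinfty {g : Perm ℕ} (hg : g ∈ Sinfty) (i : ℕ) :
    deleteValue i g ∈ Sinfty := by
  induction hg using Subgroup.closure_induction generalizing i with
  | mem x hx =>
    obtain ⟨m, rfl⟩ := hx
    rcases lt_trichotomy i m with h | h | h
    · rw [deleteValue_swap_of_lt h]
      exact (sigmaS (m - 1)).2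
    · rw [deleteValue_swap_of_eq (Or.inl h)]
      exact one_mem _
    · rcases (Nat.succ_le_of_lt h).eq_or_lt with h | h
      · rw [deleteValue_swap_of_eq (Or.inr h.symm)]
        exact one_mem _
      · rw [deleteValue_swap_of_gt h]
        exact (sigmaS m).2
  | one => rw [deleteValue_one]; exact one_mem _
  | mul x y _ _ hx hy => rw [deleteValue_mul]; exact mul_mem (hx _) (hy _)
  | inv x _ hx =>
    have h := deleteValue_mul i x⁻¹ x
    rw [inv_mul_cancel, deleteValue_one] at h
    rw [eq_inv_of_mul_eq_one_left h.symm]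
    exact inv_mem (hx _)

/-- A family of maps satisfying the cocycle rule is trivial at the identity. -/
lemma cocycle_one {δ : ℕ → Sinfty → Sinfty}
    (h : ∀ (i : ℕ) (g k : Sinfty),
      δ i (g * k) = δ i g * δ (((g⁻¹ : Sinfty) : Perm ℕ) i) k) (i : ℕ) :
    δ i 1 = 1 := by
  simpa using h i 1 1

/-- Families of maps satisfying the cocycle rule agree once they agree on the generators. -/
lemma cocycle_ext {δ ε : ℕ → Sinfty → Sinfty}
    (hδ : ∀ (i : ℕ) (g k : Sinfty),
      δ i (g * k) = δ i g * δ (((g⁻¹ : Sinfty) : Perm ℕ) i) k)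
    (hε : ∀ (i : ℕ) (g k : Sinfty),
      ε i (g * k) = ε i g * ε (((g⁻¹ : Sinfty) : Perm ℕ) i) k)
    (h : ∀ i m, δ i (sigmaS m) = ε i (sigmaS m)) : δ = ε := by
  funext i ⟨g, hg⟩
  induction hg using Subgroup.closure_induction generalizing i with
  | mem x hx =>
    obtain ⟨m, rfl⟩ := hx
    exact h i m
  | one => exact (cocycle_one hδ i).trans (cocycle_one hε i).symm
  | mul x y hx hy ihx ihy =>
    have h₁ := hδ i ⟨x, hx⟩ ⟨y, hy⟩
    rw [ihx, ihy, ← hε] at h₁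
    exact h₁
  | inv x hx ihx =>
    have h₁ := hδ i (⟨x, hx⟩ : Sinfty)⁻¹ ⟨x, hx⟩
    have h₂ := hε i (⟨x, hx⟩ : Sinfty)⁻¹ ⟨x, hx⟩
    rw [inv_mul_cancel, cocycle_one hδ, ihx] at h₁
    rw [inv_mul_cancel, cocycle_one hε] at h₂
    exact mul_right_cancel (h₁.symm.trans h₂)

/-- There exists a unique family of set-theoretic maps
`δᵢ : S∞ → S∞` (`i ∈ ℕ`) such that:
(a) `δᵢ (σₘ)` equals `σ_{m-1}` if `i < m`, the identity if `i = m` or `i = m+1`, and `σₘ` if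
`i > m+1`; and (b) `δᵢ (g*h) = δᵢ g * δ_{g⁻¹ i} h` for all `g h ∈ S∞` and `i ∈ ℕ`.
(In particular `δᵢ 1 = 1` for all `i`.) -/
theorem delta_maps_exist_unique :
    ∃! δ : ℕ → Sinfty → Sinfty,
      (∀ i m : ℕ,
        (i < m → δ i (sigmaS m) = sigmaS (m - 1)) ∧
        (i = m ∨ i = m + 1 → δ i (sigmaS m) = 1) ∧
        (m + 1 < i → δ i (sigmaS m) = sigmaS m)) ∧
      (∀ (i : ℕ) (g h : Sinfty),
        δ i (g * h) = δ i g * δ (((g⁻¹ : Sinfty) : Equiv.Perm ℕ) i) h) := by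
  refine ⟨fun i g => ⟨deleteValue i g, deleteValue_mem_Sinfty g.2 i⟩, ⟨fun i m => ⟨fun h => ?_,
    fun h => ?_, fun h => ?_⟩, fun i g h => ?_⟩, ?_⟩
  · exact Subtype.ext (deleteValue_swap_of_lt h)
  · exact Subtype.ext (deleteValue_swap_of_eq h)
  · exact Subtype.ext (deleteValue_swap_of_gt h)
  · exact Subtype.ext (deleteValue_mul i g h)
  · rintro ε ⟨hε, hmul⟩
    refine cocycle_ext hmul (fun i g h => Subtype.ext (deleteValue_mul i g h)) fun i m => ?_
    rcases lt_trichotomy i m with h | h | h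
    · exact ((hε i m).1 h).trans (Subtype.ext (deleteValue_swap_of_lt h).symm)
    · exact ((hε i m).2.1 (Or.inl h)).trans
        (Subtype.ext (deleteValue_swap_of_eq (Or.inl h)).symm)
    · rcases (Nat.succ_le_of_lt h).eq_or_lt with h | h
      · exact ((hε i m).2.1 (Or.inr h.symm)).trans
          (Subtype.ext (deleteValue_swap_of_eq (Or.inr h.symm)).symm)
      · exact ((hε i m).2.2 h).trans (Subtype.ext (deleteValue_swap_of_gt h).symm)
end

section
/- Let (G, H, j) be a Δ-groupoid. Define V₂ = H, V₃ = the set of H-composable pairs, and for n ≥ 3 let V_{n+1} be the set of n-tuples (x1, …, xn) ∈ Hⁿ such that (x_i, x_{i+1}) ∈ V₃ for 1 ≤ i ≤ n−1 and ∂_i(x1,…,xn) ∈ V_n for 1 ≤ i ≤ n+1, where ∂_1 deletes x1, ∂_{n+1} deletes xn, and ∂_i (2 ≤ i ≤ n) replaces (x_{i−1}, x_i) by their product x_{i−1}·x_i. Then for every n ≥ 2: if (x1, …, xn) ∈ V_{n+1}, then the (n−1)-tuple (y1, …, y_{n−1}) with y_i = i(j(z_i))·j(z_{i+1}), where z_i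 = x1·x2⋯x_i and i denotes groupoid inversion, is an element of V_n. -/
/-- A Δ-groupoid, presented algebraically: a groupoid with set of morphisms `M` and set of
objects `O` (composition `mul x y` is only meaningful — and only constrained by the axioms —
when `cod x = dom y`), together with a distinguished subset `H` of morphisms closed under
inversion `i` and under an involution `j` such that `i` and `j` generate an `S₃`-action on `H`
(`iji = jij`), and, writing `k = i ∘ j ∘ i`: (iii) if `x, y ∈ H` are composable then so are
`k x` and `j y`; (iv) if `(x, y)` is `H`-composable (composable with `x*y ∈ H`) then
`(k x, j y)` is `H`-composable and `k (x*y) * (k y)⁻¹ = k (k x * j y)`.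
(The requirement that `H` generates the groupoid is stated separately as
`DeltaGroupoid.Generates`.) -/
structure DeltaGroupoid where
  M : Type*
  O : Type*
  dom : M → O
  cod : M → O
  one : O → M
  inv : M → M
  mul : M → M → M
  dom_one : ∀ A, dom (one A) = A
  cod_one : ∀ A, cod (one A) = A
  dom_mul : ∀ x y, cod x = dom y → dom (mul x y) = dom x
  cod_mul : ∀ x y, cod x = dom y → cod (mul x y) = cod y
  mul_assoc' : ∀ x y z, cod x = dom y → cod y = dom z →
    mul (mul x y) z = mul x (mul y z)
  one_mul' : ∀ x, mul (one (dom x)) x = x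
  mul_one' : ∀ x, mul x (one (cod x)) = x
  dom_inv : ∀ x, dom (inv x) = cod x
  cod_inv : ∀ x, cod (inv x) = dom x
  mul_inv' : ∀ x, mul x (inv x) = one (dom x)
  inv_mul' : ∀ x, mul (inv x) x = one (cod x)
  H : Set M
  j : M → M
  inv_mem : ∀ x ∈ H, inv x ∈ H
  j_mem : ∀ x ∈ H, j x ∈ H
  j_invol : ∀ x ∈ H, j (j x) = x
  iji_eq_jij : ∀ x ∈ H, inv (j (inv x)) = j (inv (j x))
  comp_k_j : ∀ x ∈ H, ∀ y ∈ H, cod x = dom y →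
    cod (inv (j (inv x))) = dom (j y)
  Hcomp_k_j : ∀ x ∈ H, ∀ y ∈ H, cod x = dom y → mul x y ∈ H →
    mul (inv (j (inv x))) (j y) ∈ H
  pentagon : ∀ x ∈ H, ∀ y ∈ H, cod x = dom y → mul x y ∈ H →
    mul (inv (j (inv (mul x y)))) (inv (inv (j (inv y)))) =
      inv (j (inv (mul (inv (j (inv x))) (j y))))

namespace DeltaGroupoid

variable (D : DeltaGroupoid)

/-- `k = i ∘ j ∘ i`. -/
def k (x : D.M) : D.M := D.inv (D.j (D.inv x))

/-- The subgroupoid generated by `H`: the closure of `H` under inversion and composition of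
composable pairs.  A Δ-groupoid requires every morphism to lie in this closure
(`H` is a generating set). -/
inductive Generates : D.M → Prop
  | of : ∀ x ∈ D.H, Generates x
  | inv : ∀ x, Generates x → Generates (D.inv x)
  | mul : ∀ x y, Generates x → Generates y → D.cod x = D.dom y → Generates (D.mul x y)

/-- A pair `(x, y)` is `H`-composable: both lie in `H`, they are composable, and their
product lies in `H`. -/
def HComposable (x y : D.M) : Prop :=
  x ∈ D.H ∧ y ∈ D.H ∧ D.cod x = D.dom y ∧ D.mul x y ∈ D.H

/-- The face map `∂ᵢ` (`1 ≤ i ≤ n+1`) on `n`-tuples of morphisms: `∂₁` deletes the first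
entry, `∂_{n+1}` deletes the last entry, and `∂ᵢ` for `2 ≤ i ≤ n` replaces the adjacent pair
`(x_{i-1}, x_i)` by its product. -/
def face : ℕ → List D.M → List D.M
  | 1, _ :: xs => xs
  | 2, x :: y :: xs => D.mul x y :: xs
  | 2, [_] => []
  | n + 3, x :: xs => x :: face (n + 2) xs
  | _, l => l

/-- `Vtup D n` is the set `V_{n+1}` of the paper, viewed as a set of `n`-tuples:
`Vtup D 1 = H` (1-tuples), `Vtup D 2` = `H`-composable pairs, and for `n ≥ 3` an `n`-tuple
belongs to `Vtup D n` iff all its entries lie in `H`, all consecutive pairs are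
`H`-composable, and all faces `∂ᵢ` (`1 ≤ i ≤ n+1`) belong to `Vtup D (n-1)`. -/
def Vtup : ℕ → Set (List D.M)
  | 0 => ∅
  | 1 => {l | ∃ x ∈ D.H, l = [x]}
  | 2 => {l | ∃ x y, l = [x, y] ∧ D.HComposable x y}
  | n + 3 => {l | l.length = n + 3 ∧ (∀ x ∈ l, x ∈ D.H) ∧
      l.Chain' D.HComposable ∧
      ∀ i, 1 ≤ i → i ≤ n + 4 → D.face i l ∈ Vtup (n + 2)}

/-- The extra face `∂₀`: it sends `(x₁, …, xₙ)` to `(y₁, …, y_{n-1})` where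
`yᵢ = i(j(zᵢ)) * j(z_{i+1})` and `zᵢ = x₁x₂⋯xᵢ` is the `i`-th partial product. -/
def deltaZero : List D.M → List D.M
  | [] => []
  | x :: xs =>
      let z := List.scanl D.mul x xs
      List.zipWith (fun u v => D.mul (D.inv (D.j u)) (D.j v)) z z.tail

end DeltaGroupoid

namespace DeltaGroupoid

variable {D : DeltaGroupoid}

theorem inv_mul_mul {x y : D.M} (h : D.cod x = D.dom y) :
    D.mul (D.inv x) (D.mul x y) = y := by
  rw [← D.mul_assoc' _ _ _ (D.cod_inv x) h, D.inv_mul', h, D.one_mul']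

theorem mul_inv_mul {x y : D.M} (h : D.dom x = D.dom y) :
    D.mul x (D.mul (D.inv x) y) = y := by
  rw [← D.mul_assoc' _ _ _ (D.dom_inv x).symm ((D.cod_inv x).trans h), D.mul_inv', h, D.one_mul']

theorem inv_inv (x : D.M) : D.inv (D.inv x) = x := by
  have h := inv_mul_mul (D := D) (x := D.inv x) (y := x) (D.cod_inv x)
  rwa [D.inv_mul', ← D.dom_inv x, ← D.cod_inv (D.inv x), D.mul_one'] at h

theorem dom_j_eq {u v : D.M} (hu : u ∈ D.H) (hv : v ∈ D.H) (h : D.dom u = D.dom v) :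
    D.dom (D.j u) = D.dom (D.j v) := by
  simpa [inv_inv, D.cod_inv] using
    D.comp_k_j (D.inv u) (D.inv_mem u hu) v hv ((D.cod_inv u).trans h)

theorem inv_j_mul_j_mem {u v : D.M} (hu : u ∈ D.H) (hv : v ∈ D.H) (h : D.dom u = D.dom v)
    (huv : D.mul (D.inv u) v ∈ D.H) : D.mul (D.inv (D.j u)) (D.j v) ∈ D.H := by
  simpa [inv_inv] using
    D.Hcomp_k_j (D.inv u) (D.inv_mem u hu) v hv ((D.cod_inv u).trans h) huv

variable (D) in
/-- All partial products `x`, `x * x₁`, `x * x₁ * x₂`, … are defined and lie in `H`. -/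
def PartialProductsMem : D.M → List D.M → Prop
  | x, [] => x ∈ D.H
  | x, y :: ys => x ∈ D.H ∧ D.cod x = D.dom y ∧ PartialProductsMem (D.mul x y) ys

variable (D) in
/-- Consecutive entries are composable and every product of consecutive entries lies in `H`. -/
def IntervalProductsMem : List D.M → Prop
  | [] => True
  | x :: xs => IntervalProductsMem xs ∧ D.PartialProductsMem x xs

theorem PartialProductsMem.mem {x : D.M} {l : List D.M} (h : D.PartialProductsMem x l) :
    x ∈ D.H := by
  cases l with
  | nil => exact h
  | cons => exact h.1

theorem IntervalProductsMem.forall_mem {l : List D.M} (h : D.IntervalProductsMem l) :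
    ∀ x ∈ l, x ∈ D.H := by
  induction l with
  | nil => simp
  | cons x xs ih => exact List.forall_mem_cons.2 ⟨h.2.mem, ih h.1⟩

theorem IntervalProductsMem.isChain {l : List D.M} (h : D.IntervalProductsMem l) :
    l.IsChain D.HComposable := by
  induction l with
  | nil => exact .nil
  | cons x xs ih =>
    cases xs with
    | nil => exact .singleton x
    | cons y ys =>
      exact List.isChain_cons_cons.2 ⟨⟨h.2.1, h.1.2.mem, h.2.2.1, h.2.2.2.mem⟩, ih h.1⟩

theorem PartialProductsMem.face {l : List D.M} (hl : D.IntervalProductsMem l) (m : ℕ) {x : D.M}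
    (h : D.PartialProductsMem x l) : D.PartialProductsMem x (D.face (m + 2) l) := by
  induction l generalizing m x with
  | nil => cases m <;> simpa [DeltaGroupoid.face] using h
  | cons y ys ih =>
    cases m with
    | succ m => exact ⟨h.1, h.2.1, ih hl.1 m h.2.2⟩
    | zero =>
      cases ys with
      | nil => exact h.1
      | cons z zs =>
        have hyz : D.cod y = D.dom z := hl.2.2.1
        refine ⟨h.1, h.2.1.trans (D.dom_mul y z hyz).symm, ?_⟩
        rw [← D.mul_assoc' x y z h.2.1 hyz]
        exact h.2.2.2.2

theorem IntervalProductsMem.face {l : List D.M} (hl : D.IntervalProductsMem l) (m : ℕ) :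
    D.IntervalProductsMem (D.face (m + 1) l) := by
  induction l generalizing m with
  | nil => rcases m with _ | _ | m <;> exact trivial
  | cons x xs ih =>
    rcases m with _ | _ | m
    · exact hl.1
    · cases xs with
      | nil => exact trivial
      | cons y ys => exact ⟨hl.1.1, hl.2.2.2⟩
    · exact ⟨ih hl.1 (m + 1), hl.2.face hl.1 m⟩

theorem length_face {l : List D.M} {m : ℕ} (hm : m ≤ l.length) :
    (D.face (m + 1) l).length = l.length - 1 := by
  induction l generalizing m with
  | nil =>
    obtain rfl : m = 0 := by simpa using hm
    rfl
  | cons x xs ih =>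
    rcases m with _ | _ | m
    · rfl
    · cases xs <;> rfl
    · have hm' : m + 1 ≤ xs.length := by simpa using hm
      rw [DeltaGroupoid.face, List.length_cons, ih hm', List.length_cons]
      omega

theorem mem_Vtup_succ_iff (n : ℕ) (l : List D.M) :
    l ∈ D.Vtup (n + 1) ↔ l.length = n + 1 ∧ D.IntervalProductsMem l := by
  induction n generalizing l with
  | zero =>
    constructor
    · rintro ⟨x, hx, rfl⟩
      exact ⟨rfl, trivial, hx⟩
    · rintro ⟨hlen, hl⟩
      obtain ⟨x, rfl⟩ := List.length_eq_one_iff.1 hlen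
      exact ⟨x, hl.2, rfl⟩
  | succ n ih =>
    cases n with
    | zero =>
      constructor
      · rintro ⟨x, y, rfl, hx, hy, hxy, hmul⟩
        exact ⟨rfl, ⟨trivial, hy⟩, hx, hxy, hmul⟩
      · rintro ⟨hlen, hl⟩
        obtain ⟨x, y, rfl⟩ := List.length_eq_two.1 hlen
        exact ⟨x, y, rfl, hl.2.1, hl.1.2, hl.2.2.1, hl.2.2.2⟩
    | succ n =>
      constructor
      · rintro ⟨hlen, hmem, hchain, hface⟩
        refine ⟨hlen, ?_⟩
        match l, hlen with
        | x :: y :: zs, _ =>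
          have h₁ := ((ih _).1 (hface 1 le_rfl (by omega))).2
          have h₂ := ((ih _).1 (hface 2 (by omega) (by omega))).2
          exact ⟨h₁, hmem x (by simp), (List.isChain_cons_cons.1 hchain).1.2.2.1, h₂.2⟩
      · rintro ⟨hlen, hl⟩
        refine ⟨hlen, hl.forall_mem, hl.isChain, fun i hi hin => (ih _).2 ?_⟩
        obtain ⟨m, rfl⟩ := Nat.exists_eq_add_of_le' hi
        exact ⟨by rw [length_face (by omega), hlen]; rfl, hl.face m⟩

theorem deltaZero_cons_cons (x y : D.M) (l : List D.M) :
    D.deltaZero (x :: y :: l) =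
      D.mul (D.inv (D.j x)) (D.j (D.mul x y)) :: D.deltaZero (D.mul x y :: l) := by
  cases l <;> simp [deltaZero]

theorem length_deltaZero (l : List D.M) : (D.deltaZero l).length = l.length - 1 := by
  cases l <;> simp [deltaZero]

theorem PartialProductsMem.deltaZero {u v : D.M} {l : List D.M} (hu : u ∈ D.H)
    (huv : D.dom u = D.dom v) (hv : D.PartialProductsMem v l)
    (h : D.PartialProductsMem (D.mul (D.inv u) v) l) :
    D.PartialProductsMem (D.mul (D.inv (D.j u)) (D.j v)) (D.deltaZero (v :: l)) := by
  induction l generalizing v with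
  | nil => exact inv_j_mul_j_mem hu hv huv h
  | cons y ys ih =>
    obtain ⟨hvH, hvy, hvys⟩ := hv
    have hdom : D.dom (D.mul v y) = D.dom v := D.dom_mul v y hvy
    have hjuv : D.cod (D.inv (D.j u)) = D.dom (D.j v) :=
      (D.cod_inv _).trans (dom_j_eq hu hvH huv)
    have hjv : D.dom (D.j v) = D.dom (D.j (D.mul v y)) := dom_j_eq hvH hvys.mem hdom.symm
    have hcod : D.cod (D.inv (D.j v)) = D.dom (D.j (D.mul v y)) := (D.cod_inv _).trans hjv
    rw [deltaZero_cons_cons]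
    refine ⟨inv_j_mul_j_mem hu hvH huv h.1, ?_, ?_⟩
    · rw [D.cod_mul _ _ hjuv, D.dom_mul _ _ hcod, D.dom_inv]
    · rw [D.mul_assoc' _ _ _ hjuv (by rw [D.dom_mul _ _ hcod, D.dom_inv]), mul_inv_mul hjv]
      refine ih (huv.trans hdom.symm) hvys ?_
      rw [← D.mul_assoc' _ _ _ ((D.cod_inv u).trans huv) hvy]
      exact h.2.2

theorem IntervalProductsMem.deltaZero {x : D.M} {l : List D.M}
    (h : D.IntervalProductsMem (x :: l)) : D.IntervalProductsMem (D.deltaZero (x :: l)) := by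
  induction l generalizing x with
  | nil => exact trivial
  | cons y ys ih =>
    have hxy : D.cod x = D.dom y := h.2.2.1
    rw [deltaZero_cons_cons]
    refine ⟨ih ⟨h.1.1, h.2.2.2⟩, h.2.2.2.deltaZero h.2.1 (D.dom_mul x y hxy).symm ?_⟩
    rw [inv_mul_mul hxy]
    exact h.1.2

end DeltaGroupoid

/-- Let `(G, H, j)` be a Δ-groupoid (so in particular `H` generates `G`).
For every `n ≥ 2`, if the `n`-tuple `(x₁, …, xₙ)` lies in `V_{n+1}`, then the `(n-1)`-tuple
`(y₁, …, y_{n-1})`, `yᵢ = i(j(zᵢ)) * j(z_{i+1})` with `zᵢ = x₁x₂⋯xᵢ`, lies in `Vₙ`. -/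
theorem deltaZero_mem_Vtup (D : DeltaGroupoid) (hgen : ∀ m : D.M, D.Generates m) :
    ∀ n : ℕ, 2 ≤ n → ∀ l ∈ D.Vtup n, D.deltaZero l ∈ D.Vtup (n - 1) := by
  intro n hn l hl
  obtain ⟨m, rfl⟩ := Nat.exists_eq_add_of_le' hn
  obtain ⟨hlen, hl⟩ := (DeltaGroupoid.mem_Vtup_succ_iff (m + 1) l).1 hl
  refine (DeltaGroupoid.mem_Vtup_succ_iff m _).2 ⟨?_, ?_⟩
  · rw [DeltaGroupoid.length_deltaZero, hlen]
    rfl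
  · cases l with
    | nil => exact trivial
    | cons x xs => exact hl.deltaZero
end
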